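/- arXiv:1412.0609 — 3 statements merged into one kernel-verified Lean document; each statement's English description precedes it below -/
import Mathlib

section
/- Let f and g be continuous, positive, non-increasing functions on [0,∞), let r ∈ ℕ with r ≥ 2, and assume φ_{r,0,f}(∞) < ∞. For M > 0 let G_M := G_{r,0,f,M} be the perfect g-spline with no knots on [0, M] having r+1 oscillation points, and for k = 0, 1, …, r−2 let α_{k+1}^M denote the first zero of G_M^{(r−k−1)} in [0, M]. Then |G_M^{(r−k−1)}(0)| → A_k and α_{k+1}^M → ∞ as M → ∞, for each k = 0, 1, …, r−2. -/
open Set Filter MeasureTheory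
open scoped Topology

noncomputable section

/-- Weighted sup-norm `‖x‖_{C(S),w} = sup_{t ∈ S} |x t| / w t`. -/
def wNorm (x w : ℝ → ℝ) (S : Set ℝ) : ℝ :=
  sSup ((fun t => |x t| / w t) '' S)

/-- Sup-norm `‖x‖_{C(S)} = sup_{t ∈ S} |x t|`. -/
def supNorm (x : ℝ → ℝ) (S : Set ℝ) : ℝ :=
  sSup ((fun t => |x t|) '' S)

/-- `G` is a perfect `g`-spline of order `r` on `[0,a]` with exactly `m` knots
`u 1 < ⋯ < u m` (where `u 0 = 0` and `u (m+1) = a`) and sign `ε ∈ {1,-1}`: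
`G ∈ C^{r-1}[0,a]`, and on each open interval between consecutive knots `G` is
`r` times differentiable with `G^{(r)}(t) = ε·(-1)^i·g(t)` there. -/
def PerfectSplineWith (g : ℝ → ℝ) (r : ℕ) (a : ℝ) (m : ℕ) (u : ℕ → ℝ) (ε : ℝ)
    (G : ℝ → ℝ) : Prop :=
  (ε = 1 ∨ ε = -1) ∧ u 0 = 0 ∧ u (m + 1) = a ∧ (∀ i ≤ m, u i < u (i + 1)) ∧
  ContDiffOn ℝ (r - 1 : ℕ) G (Icc 0 a) ∧
  ∀ i ≤ m, ContDiffOn ℝ (r : ℕ) G (Ioo (u i) (u (i + 1))) ∧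
    ∀ s ∈ Ioo (u i) (u (i + 1)),
      iteratedDerivWithin r G (Ioo (u i) (u (i + 1))) s = ε * (-1 : ℝ) ^ i * g s

/-- `Γ^r_{n,g}[0,a]`: perfect `g`-splines of order `r` on `[0,a]` with at most `n` knots. -/
def InGamma (g : ℝ → ℝ) (r n : ℕ) (a : ℝ) (G : ℝ → ℝ) : Prop :=
  ∃ m ≤ n, ∃ u : ℕ → ℝ, ∃ ε : ℝ, PerfectSplineWith g r a m u ε G

/-- `b 1 < ⋯ < b (n+r+1)` are `n+r+1` oscillation points of `G` on `[0,a]`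
with respect to the weight `f`, as in (5). -/
def OscPointsAt (f : ℝ → ℝ) (r n : ℕ) (a : ℝ) (G : ℝ → ℝ) (b : ℕ → ℝ) : Prop :=
  0 ≤ b 1 ∧ b (n + r + 1) = a ∧ (∀ i, 1 ≤ i → i < n + r + 1 → b i < b (i + 1)) ∧
  ∀ i, 1 ≤ i → i ≤ n + r + 1 →
    G (b i) = (-1 : ℝ) ^ (i + r + 1) * (wNorm G f (Icc 0 a) * f (b i))

/-- `G` has `n+r+1` oscillation points on `[0,a]`. -/
def HasOsc (f : ℝ → ℝ) (r n : ℕ) (a : ℝ) (G : ℝ → ℝ) : Prop :=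
  ∃ b : ℕ → ℝ, OscPointsAt f r n a G b

/-- `G` is the extremal spline `G_{r,n,f,a}`: a member of `Γ^r_{n,g}[0,a]`
with `n+r+1` oscillation points. -/
def IsExtremalSpline (f g : ℝ → ℝ) (r n : ℕ) (a : ℝ) (G : ℝ → ℝ) : Prop :=
  InGamma g r n a G ∧ HasOsc f r n a G

/-- Iterated antiderivatives: `g_0 = g`, `g_{k+1}(t) = ∫_0^t g_k`. -/
def gk (g : ℝ → ℝ) : ℕ → ℝ → ℝ
  | 0 => g
  | k + 1 => fun t => ∫ s in (0:ℝ)..t, gk g k s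

/-- The constants `A_k` of the paper:
`A_0 = ∫_0^∞ g`, and
`A_k = ∫_0^∞ [ Σ_{s=0}^{k-1} (-1)^{k-s-1} A_s t^{k-s-1}/(k-s-1)! + (-1)^k g_k(t) ] dt`. -/
def Acoef (g : ℝ → ℝ) : ℕ → ℝ
  | 0 => ∫ t in Ioi (0 : ℝ), g t
  | k + 1 => ∫ t in Ioi (0 : ℝ),
      ((∑ s : Fin (k + 1), (-1 : ℝ) ^ (k - s.1) * Acoef g s.1 * t ^ (k - s.1) /
        (Nat.factorial (k - s.1) : ℝ)) + (-1 : ℝ) ^ (k + 1) * gk g (k + 1) t)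

/-- `P_k(t) = Σ_{s=0}^{k-1} (-1)^{k-s-1} A_s t^{k-s-1}/(k-s-1)! + (-1)^k g_k(t)`. -/
def Pfun (g : ℝ → ℝ) (k : ℕ) (t : ℝ) : ℝ :=
  (∑ s : Fin k, (-1 : ℝ) ^ (k - 1 - s.1) * Acoef g s.1 * t ^ (k - 1 - s.1) /
    (Nat.factorial (k - 1 - s.1) : ℝ)) + (-1 : ℝ) ^ k * gk g k t

/-- Conditions (6): `A_0 < ∞` and `A_k < ∞` for `k = 1, …, r-1`,
expressed as integrability of the corresponding integrands over `(0,∞)`. -/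
def Cond6 (g : ℝ → ℝ) (r : ℕ) : Prop :=
  IntegrableOn g (Ioi 0) ∧ ∀ k, 1 ≤ k → k ≤ r - 1 → IntegrableOn (Pfun g k) (Ioi 0)

/-- Membership in the class `W^r_{f,g}(ℝ₊)`: `x ∈ C[0,∞)` with
`‖x‖_{C[0,∞),f} < ∞`, `x ∈ C^{r-1}[0,∞)`, `x^{(r-1)}` locally absolutely
continuous with `|x^{(r)}| ≤ g` a.e., the latter encoded by the increment bound
`|x^{(r-1)}(t) - x^{(r-1)}(s)| ≤ ∫_s^t g`. -/
def MemW (f g : ℝ → ℝ) (r : ℕ) (x : ℝ → ℝ) : Prop :=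
  ContinuousOn x (Ici 0) ∧
  ContDiffOn ℝ (r - 1 : ℕ) x (Ici 0) ∧
  BddAbove ((fun t => |x t| / f t) '' Ici 0) ∧
  ∀ s t : ℝ, 0 ≤ s → s ≤ t →
    |iteratedDerivWithin (r - 1) x (Ici 0) t - iteratedDerivWithin (r - 1) x (Ici 0) s| ≤
      ∫ u in s..t, g u

/-- The modulus of continuity `ω(D^k, δ)` of the `k`-th differentiation operator on
`W^r_{f,g}(ℝ₊)`. -/
def omegaD (f g : ℝ → ℝ) (r k : ℕ) (δ : ℝ) : ℝ :=
  sSup {y | ∃ x : ℝ → ℝ, MemW f g r x ∧ wNorm x f (Ici 0) ≤ δ ∧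
    y = supNorm (iteratedDerivWithin k x (Ici 0)) (Ici 0)}

/-- A perfect `g`-spline of order `r` on `[0,∞)` with exactly `n` knots
`u 1 < ⋯ < u n` (and `u 0 = 0`), sign `ε`. -/
def PerfectSplineInf (g : ℝ → ℝ) (r n : ℕ) (u : ℕ → ℝ) (ε : ℝ) (Q : ℝ → ℝ) : Prop :=
  (ε = 1 ∨ ε = -1) ∧ u 0 = 0 ∧ (∀ i < n, u i < u (i + 1)) ∧
  ContDiffOn ℝ (r - 1 : ℕ) Q (Ici 0) ∧
  (∀ i < n, ContDiffOn ℝ (r : ℕ) Q (Ioo (u i) (u (i + 1))) ∧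
    ∀ s ∈ Ioo (u i) (u (i + 1)),
      iteratedDerivWithin r Q (Ioo (u i) (u (i + 1))) s = ε * (-1 : ℝ) ^ i * g s) ∧
  ContDiffOn ℝ (r : ℕ) Q (Ioi (u n)) ∧
  ∀ s ∈ Ioi (u n), iteratedDerivWithin r Q (Ioi (u n)) s = ε * (-1 : ℝ) ^ n * g s

end

def Chain (M : ℝ) (r : ℕ) (h : ℕ → ℝ → ℝ) : Prop :=
  (∀ k < r, ContinuousOn (h (k+1)) (Icc 0 M)) ∧
    ∀ k < r, ∀ t ∈ Ioo (0:ℝ) M, HasDerivAt (h (k+1)) (-(h k t)) t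

lemma Chain.neg {M : ℝ} {r : ℕ} {h : ℕ → ℝ → ℝ} (hc : Chain M r h) :
    Chain M r (fun k t => -(h k t)) :=
  ⟨fun k hk => (hc.1 k hk).neg, fun k hk t ht => (hc.2 k hk t ht).neg⟩

lemma Chain.sub {M : ℝ} {r : ℕ} {h h' : ℕ → ℝ → ℝ} (hc : Chain M r h) (hc' : Chain M r h') :
    Chain M r (fun k t => h k t - h' k t) :=
  ⟨fun k hk => (hc.1 k hk).sub (hc'.1 k hk), fun k hk t ht => by
    refine ((hc.2 k hk t ht).sub (hc'.2 k hk t ht)).congr_deriv ?_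
    change _ = -(h k t - h' k t)
    ring⟩

lemma Chain.mvt {M : ℝ} {r : ℕ} {h : ℕ → ℝ → ℝ} (hc : Chain M r h) {k : ℕ} (hk : k < r)
    {a b : ℝ} (ha : 0 ≤ a) (hab : a < b) (hb : b ≤ M) :
    ∃ y ∈ Ioo a b, h (k+1) a - h (k+1) b = h k y * (b - a) := by
  obtain ⟨y, hy, he⟩ := exists_hasDerivAt_eq_slope (h (k+1)) (fun t => -(h k t)) hab
    ((hc.1 k hk).mono (Icc_subset_Icc ha hb))
    (fun t ht => hc.2 k hk t ⟨ha.trans_lt ht.1, ht.2.trans_le hb⟩)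
  refine ⟨y, hy, ?_⟩
  have : b - a ≠ 0 := by linarith
  rw [eq_div_iff this] at he
  linarith

lemma Chain.drop {M : ℝ} {r : ℕ} {h : ℕ → ℝ → ℝ} (hc : Chain M r h) {k : ℕ} (hk : k < r)
    {a b c : ℝ} (ha : 0 ≤ a) (hab : a ≤ b) (hb : b ≤ M) (hh : ∀ t ∈ Icc a b, c ≤ h k t) :
    h (k+1) b ≤ h (k+1) a - c * (b - a) := by
  rcases hab.eq_or_lt with rfl | hab
  · simp
  obtain ⟨y, hy, he⟩ := hc.mvt hk ha hab hb
  have := mul_le_mul_of_nonneg_right (hh y ⟨hy.1.le, hy.2.le⟩) (sub_nonneg.2 hab.le)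
  linarith

lemma Chain.landau (j : ℕ) : ∃ K : ℝ, 0 ≤ K ∧ ∀ (M : ℝ) (r : ℕ) (h : ℕ → ℝ → ℝ) (k : ℕ)
    (a b c B : ℝ), Chain M r h → k + j ≤ r → 0 ≤ a → a ≤ b → b ≤ M → 0 ≤ c →
    (∀ t ∈ Icc a b, c ≤ h k t) → (∀ t ∈ Icc a b, |h (k + j) t| ≤ B) →
    c * (b - a) ^ j ≤ K * B := by
  induction j with
  | zero =>
    refine ⟨1, zero_le_one, ?_⟩
    intro M r h k a b c B _ _ _ hab _ _ h1 h2
    have h1 := h1 a ⟨le_rfl, hab⟩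
    have h2 := h2 a ⟨le_rfl, hab⟩
    have := le_abs_self (h k a)
    simp at h2 ⊢
    linarith
  | succ j ih =>
    obtain ⟨K, hK, ih⟩ := ih
    refine ⟨4 ^ (j+1) * K, by positivity, ?_⟩
    intro M r h k a b c B hc hkj ha hab hb hc0 h1 h2
    have hkr : k < r := by omega
    have hjj : k + (j + 1) = k + 1 + j := by omega
    rw [hjj] at h2 hkj
    set l := (b - a) / 4 with hl
    have hl0 : 0 ≤ l := by rw [hl]; linarith
    have hba : b - a = 4 * l := by rw [hl]; ring
    have key : c * l * l ^ j ≤ K * B := by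
      by_cases hm : 0 ≤ h (k+1) (a + 2 * l)
      · have := ih M r h (k+1) a (a + l) (c * l) B hc hkj ha (by linarith) (by linarith)
          (by positivity) ?_ (fun t ht => h2 t ⟨ht.1, by linarith [ht.2]⟩)
        · simpa using this
        · intro t ht
          have h3 := hc.drop hkr (a := t) (b := a + 2 * l) (c := c) (by linarith [ht.1])
            (by linarith [ht.2]) (by linarith)
            (fun s hs => h1 s ⟨by linarith [ht.1, hs.1], by linarith [hs.2]⟩)
          have := mul_le_mul_of_nonneg_left (show l ≤ a + 2 * l - t by linarith [ht.2]) hc0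
          linarith
      · have := ih M r (fun k t => -(h k t)) (k+1) (a + 3 * l) (a + 4 * l) (c * l) B hc.neg hkj
          (by linarith) (by linarith) (by linarith)
          (by positivity) ?_ (fun t ht => by
            rw [abs_neg]; exact h2 t ⟨by linarith [ht.1], by linarith [ht.2]⟩)
        · have e : a + 4 * l - (a + 3 * l) = l := by ring
          rwa [e] at this
        · intro t ht
          have h3 := hc.drop hkr (a := a + 2 * l) (b := t) (c := c) (by linarith [ht.1])
            (by linarith [ht.1]) (by linarith [ht.2])
            (fun s hs => h1 s ⟨by linarith [ht.1, hs.1], by linarith [hs.2, ht.2]⟩)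
          have := mul_le_mul_of_nonneg_left (show l ≤ t - (a + 2 * l) by linarith [ht.1]) hc0
          linarith
    rw [hba]
    calc c * (4 * l) ^ (j+1) = 4 ^ (j+1) * (c * l * l ^ j) := by rw [mul_pow, pow_succ l]; ring
      _ ≤ 4 ^ (j+1) * (K * B) := by gcongr
      _ = _ := by ring

/-- weak alternation step -/
lemma Chain.step {M : ℝ} {r : ℕ} {h : ℕ → ℝ → ℝ} (hc : Chain M r h) {k : ℕ} (hk : k < r)
    (n : ℕ) (σ : ℝ) (x : ℕ → ℝ) (hx : ∀ i ≤ n + 1, x i ∈ Icc 0 M)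
    (hlt : ∀ i ≤ n, x i < x (i+1)) (h0 : 0 ≤ σ * h (k+1) (x 0))
    (hs : ∀ i ≤ n, 0 < (-1) ^ (i+1) * σ * h (k+1) (x (i+1))) :
    ∃ y : ℕ → ℝ, (∀ i ≤ n, y i ∈ Ioo (x i) (x (i+1))) ∧
      ∀ i ≤ n, 0 < (-1) ^ i * σ * h k (y i) := by
  have : ∀ i, ∃ y, i ≤ n → y ∈ Ioo (x i) (x (i+1)) ∧ 0 < (-1) ^ i * σ * h k y := by
    intro i
    by_cases hi : i ≤ n
    · obtain ⟨y, hy, he⟩ := hc.mvt hk (hx i (by omega)).1 (hlt i hi) (hx (i+1) (by omega)).2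
      refine ⟨y, fun _ => ⟨hy, ?_⟩⟩
      have h1 : 0 ≤ (-1) ^ i * σ * h (k+1) (x i) := by
        cases i with
        | zero => simpa using h0
        | succ i => exact (hs i (by omega)).le
      have h2 := hs i hi
      have h3 : 0 < ((-1) ^ i * σ * h k y) * (x (i+1) - x i) := by
        have : ((-1) ^ i * σ * h k y) * (x (i+1) - x i)
          = (-1) ^ i * σ * (h (k+1) (x i) - h (k+1) (x (i+1))) := by rw [he]; ring
        rw [this]
        rw [pow_succ] at h2
        linarith
      exact pos_of_mul_pos_left h3 (sub_nonneg.2 (hlt i hi).le)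
    · exact ⟨0, fun h => absurd h hi⟩
  choose y hy using this
  exact ⟨y, fun i hi => (hy i hi).1, fun i hi => (hy i hi).2⟩

def Alt (M : ℝ) (h : ℕ → ℝ → ℝ) (k n : ℕ) (σ : ℝ) : Prop :=
  ∃ x : ℕ → ℝ, (∀ i ≤ n, x i ∈ Icc 0 M) ∧ (∀ i < n, x i < x (i+1)) ∧
    ∀ i ≤ n, 0 < (-1) ^ i * σ * h k (x i)

lemma Chain.step_alt {M : ℝ} {r : ℕ} {h : ℕ → ℝ → ℝ} (hc : Chain M r h) {k : ℕ} (hk : k < r)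
    (n : ℕ) (σ : ℝ) (x : ℕ → ℝ) (hx : ∀ i ≤ n + 1, x i ∈ Icc 0 M)
    (hlt : ∀ i ≤ n, x i < x (i+1)) (h0 : 0 ≤ σ * h (k+1) (x 0))
    (hs : ∀ i ≤ n, 0 < (-1) ^ (i+1) * σ * h (k+1) (x (i+1))) :
    Alt M h k n σ := by
  obtain ⟨y, hy, hp⟩ := hc.step hk n σ x hx hlt h0 hs
  refine ⟨y, fun i hi => ⟨(hx i (by omega)).1.trans (hy i hi).1.le,
    (hy i hi).2.le.trans (hx (i+1) (by omega)).2⟩, fun i hi => ?_, hp⟩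
  exact (hy i hi.le).2.trans (hy (i+1) (by omega)).1

lemma Chain.alt_down {M : ℝ} {r : ℕ} {h : ℕ → ℝ → ℝ} (hc : Chain M r h) {k n : ℕ} (σ : ℝ)
    (j : ℕ) (hk : k + j ≤ r) (ha : Alt M h (k+j) (n+j) σ) : Alt M h k n σ := by
  induction j with
  | zero => exact ha
  | succ j ih =>
    refine ih (by omega) ?_
    obtain ⟨x, hx, hlt, hs⟩ := ha
    exact hc.step_alt (k := k + j) (by omega) (n+j) σ x hx (fun i hi => hlt i (by omega))
      (by have := (hs 0 (by omega)).le; rwa [pow_zero, one_mul] at this) (fun i hi => hs (i+1) (by omega))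

lemma Chain.no_alt {M : ℝ} {r : ℕ} {h : ℕ → ℝ → ℝ} (hc : Chain M r h)
    (hpos : ∀ t ∈ Icc 0 M, 0 < h 0 t) (m : ℕ) (hm : m ≤ r) (σ : ℝ) : ¬ Alt M h m (m+1) σ := by
  intro ha
  have : Alt M h 0 1 σ := by
    apply hc.alt_down σ m (by omega)
    rwa [zero_add, add_comm 1 m]
  obtain ⟨x, hx, _, hs⟩ := this
  have h0 := hs 0 (by omega)
  have h1 := hs 1 le_rfl
  have p0 := hpos _ (hx 0 (by omega))
  have p1 := hpos _ (hx 1 le_rfl)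
  simp at h0 h1
  have := pos_of_mul_pos_left h0 p0.le
  have := mul_pos this p1
  linarith

lemma Chain.pos_before {M : ℝ} {r : ℕ} {h : ℕ → ℝ → ℝ} (hc : Chain M r h)
    (hpos : ∀ t ∈ Icc 0 M, 0 < h 0 t) (m : ℕ) (hm : m ≤ r) (x : ℕ → ℝ)
    (hx : ∀ i ≤ m, x i ∈ Icc 0 M) (hlt : ∀ i < m, x i < x (i+1))
    (hs : ∀ i ≤ m, 0 < (-1) ^ i * h m (x i)) : ∀ t ∈ Icc 0 (x 0), 0 < h m t := by
  intro t ht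
  cases m with
  | zero => exact hpos t ⟨ht.1, ht.2.trans (hx 0 le_rfl).2⟩
  | succ k =>
    by_contra hn
    push Not at hn
    have hs0 := hs 0 (by omega)
    simp at hs0
    have htx : t < x 0 := by
      rcases ht.2.eq_or_lt with e | e
      · rw [e] at hn; linarith
      · exact e
    refine hc.no_alt hpos k (by omega) (-1) (hc.step_alt (k := k) (by omega) (k+1) (-1)
      (fun i => Nat.casesOn i t x) ?_ ?_ ?_ ?_)
    · intro i hi
      cases i with
      | zero => exact ⟨ht.1, ht.2.trans (hx 0 (by omega)).2⟩
      | succ i => exact hx i (by omega)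
    · intro i hi
      cases i with
      | zero => exact htx
      | succ i => exact hlt i (by omega)
    · simpa using hn
    · intro i hi
      have := hs i hi
      simp only [pow_succ]
      linarith

lemma Chain.first_zero {M : ℝ} {r : ℕ} {h : ℕ → ℝ → ℝ} (hc : Chain M r h)
    (hpos : ∀ t ∈ Icc 0 M, 0 < h 0 t) (hr : Alt M h r r 1) (k : ℕ) (hk : k < r) (α : ℝ)
    (hα : IsLeast {t ∈ Icc (0:ℝ) M | h (k+1) t = 0} α) :
    ∀ t ∈ Ico 0 α, 0 < h (k+1) t := by
  have ha : Alt M h (k+1) (k+1) 1 := by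
    obtain ⟨j, rfl⟩ : ∃ j, r = k + 1 + j := ⟨r - (k+1), by omega⟩
    exact hc.alt_down 1 j le_rfl hr
  obtain ⟨x, hx, hlt, hs⟩ := ha
  simp only [mul_one] at hs
  have hp := hc.pos_before hpos (k+1) (by omega) x hx hlt hs
  intro t ht
  have hp0 := hp 0 ⟨le_rfl, (hx 0 (by omega)).1⟩
  by_contra hn
  push Not at hn
  have hαM := hα.1.1
  obtain ⟨z, hz, hz0⟩ := intermediate_value_Icc' ht.1
    ((hc.1 k hk).mono (Icc_subset_Icc le_rfl (ht.2.le.trans hαM.2))) ⟨hn, hp0.le⟩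
  have := hα.2 ⟨⟨hz.1, hz.2.trans (ht.2.le.trans hαM.2)⟩, hz0⟩
  linarith [hz.2, ht.2]

lemma Chain.anti {M : ℝ} {r : ℕ} {h : ℕ → ℝ → ℝ} (hc : Chain M r h) {k : ℕ} (hk : k < r)
    {T : ℝ} (hT : T ≤ M) (hh : ∀ t ∈ Icc 0 T, 0 ≤ h k t) : AntitoneOn (h (k+1)) (Icc 0 T) := by
  intro a ha b hb hab
  have := hc.drop hk ha.1 hab (hb.2.trans hT)
    (fun t ht => hh t ⟨ha.1.trans ht.1, ht.2.trans hb.2⟩)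
  simpa using this

section core
variable {g : ℝ → ℝ} {r : ℕ} {H : ℝ → ℕ → ℝ → ℝ} {B : ℝ} {α : ℕ → ℝ → ℝ}

lemma core_alpha
    (hch : ∀ M, 0 < M → Chain M r (H M))
    (hB : ∀ M, 0 < M → ∀ t ∈ Icc 0 M, |H M r t| ≤ B)
    (k : ℕ) (hk : k + 1 < r)
    (hα : ∀ M, 0 < M → α k M ∈ Icc 0 M ∧ H M (k+1) (α k M) = 0)
    (hS : ∀ T, ∃ c, 0 < c ∧ ∀ᶠ M in atTop, ∀ t ∈ Icc 0 T, c ≤ H M k t) :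
    Tendsto (fun M => α k M) atTop atTop := by
  obtain ⟨j, hj⟩ : ∃ j, r = k + 1 + (j + 1) := ⟨r - k - 2, by omega⟩
  obtain ⟨K, hK, hL⟩ := Chain.landau (j+1)
  rw [tendsto_atTop]
  intro L0
  obtain ⟨L, hL0, hLL⟩ : ∃ L : ℝ, 0 ≤ L ∧ L0 ≤ L := ⟨max L0 0, le_max_right _ _, le_max_left _ _⟩
  obtain ⟨c, hc0, hc⟩ := hS (L+1)
  have hB0 : 0 ≤ B := (abs_nonneg _).trans (hB 1 one_pos 0 ⟨le_rfl, zero_le_one⟩)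
  obtain ⟨N, hN⟩ : ∃ N : ℝ, N = (K * B + 1) / c + 1 := ⟨_, rfl⟩
  have hN1 : 1 ≤ N := by
    have : 0 ≤ (K * B + 1) / c := by positivity
    linarith
  obtain ⟨c', hc0', hc'⟩ := hS (L + 1 + N)
  filter_upwards [hc, hc', eventually_ge_atTop (L + 1 + N)] with M h1 h2 hM
  have hM0 : 0 < M := by linarith
  by_contra hn
  push Not at hn
  have hCh := hch M hM0
  obtain ⟨ha, ha0⟩ := hα M hM0
  have h3 := hCh.drop (by omega) ha.1 (show α k M ≤ L + 1 by linarith) (by linarith)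
    (fun t ht => h1 t ⟨ha.1.trans ht.1, ht.2⟩)
  rw [ha0] at h3
  have h4 : c * 1 ≤ c * (L + 1 - α k M) := by
    apply mul_le_mul_of_nonneg_left _ hc0.le
    linarith
  have hanti := hCh.anti (k := k) (by omega) hM (fun t ht => hc0'.le.trans (h2 t ht))
  have := hL M r (fun k t => -(H M k t)) (k+1) (L+1) (L+1+N) c B hCh.neg (by omega)
    (by linarith) (by linarith) hM hc0.le ?_ ?_
  · have e : L + 1 + N - (L + 1) = N := by ring
    rw [e] at this
    have h5 : N ≤ N ^ (j+1) := le_self_pow₀ hN1 (by omega)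
    have h6 := mul_le_mul_of_nonneg_left h5 hc0.le
    have h7 : c * N = K * B + 1 + c := by
      rw [hN]; field_simp
    linarith
  · intro t ht
    have := hanti (a := L + 1) (b := t) ⟨by linarith, by linarith⟩ ⟨by linarith [ht.1], ht.2⟩ ht.1
    linarith
  · intro t ht
    rw [abs_neg, ← hj]
    exact hB M hM0 t ⟨by linarith [ht.1], by linarith [ht.2]⟩

lemma core_low
    (hch : ∀ M, 0 < M → Chain M r (H M))
    (k : ℕ) (hk : k + 1 < r)
    (hαM : ∀ M, 0 < M → α k M ≤ M)
    (hα : ∀ M, 0 < M → ∀ t ∈ Ico 0 (α k M), 0 < H M (k+1) t)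
    (hS : ∀ T, ∃ c, 0 < c ∧ ∀ᶠ M in atTop, ∀ t ∈ Icc 0 T, c ≤ H M k t)
    (hT : Tendsto (fun M => α k M) atTop atTop) :
    ∀ T, ∃ c, 0 < c ∧ ∀ᶠ M in atTop, ∀ t ∈ Icc 0 T, c ≤ H M (k+1) t := by
  intro T
  obtain ⟨c, hc0, hc⟩ := hS (T+1)
  refine ⟨c, hc0, ?_⟩
  filter_upwards [hc, hT.eventually_gt_atTop (T+1), eventually_gt_atTop 0] with M h1 h2 hM t ht
  have h3 := (hch M hM).drop (k := k) (by omega) ht.1 (show t ≤ t + 1 by linarith)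
    (by linarith [hαM M hM, ht.2])
    (fun s hs => h1 s ⟨ht.1.trans hs.1, hs.2.trans (by linarith [ht.2])⟩)
  have h4 := hα M hM (t+1) ⟨by linarith [ht.1], by linarith [ht.2]⟩
  have : c * (t + 1 - t) = c := by ring
  linarith

lemma core_S
    (hg_pos : ∀ t ∈ Ici (0:ℝ), 0 < g t)
    (hg_anti : AntitoneOn g (Ici 0))
    (hch : ∀ M, 0 < M → Chain M r (H M)) (h0 : ∀ M, 0 < M → H M 0 = g)
    (hB : ∀ M, 0 < M → ∀ t ∈ Icc 0 M, |H M r t| ≤ B)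
    (hα : ∀ k, k + 1 < r → ∀ M, 0 < M → α k M ∈ Icc 0 M ∧ H M (k+1) (α k M) = 0 ∧
      ∀ t ∈ Ico 0 (α k M), 0 < H M (k+1) t)
    (k : ℕ) (hk : k < r) :
    ∀ T, ∃ c, 0 < c ∧ ∀ᶠ M in atTop, ∀ t ∈ Icc 0 T, c ≤ H M k t := by
  induction k with
  | zero =>
    intro T
    refine ⟨g (max T 0), hg_pos _ (mem_Ici.2 (le_max_right T 0)), ?_⟩
    filter_upwards [eventually_gt_atTop 0] with M hM t ht
    rw [h0 M hM]
    exact hg_anti ht.1 (le_max_right T 0) (ht.2.trans (le_max_left _ _))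
  | succ k ih =>
    have ih := ih (by omega)
    exact core_low hch k hk (fun M hM => (hα k hk M hM).1.2) (fun M hM => (hα k hk M hM).2.2) ih
      (core_alpha hch hB k hk (fun M hM => ⟨(hα k hk M hM).1, (hα k hk M hM).2.1⟩) ih)

lemma gk_cont (hg_c : ContinuousOn g (Ici 0)) (k : ℕ) : ContinuousOn (gk g k) (Ici 0) := by
  induction k with
  | zero => exact hg_c
  | succ k ih =>
    intro t ht
    have h1 : ContinuousOn (fun t => ∫ s in (0:ℝ)..t, gk g k s) (uIcc 0 (t+1)) := by
      apply intervalIntegral.continuousOn_primitive_interval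
      rw [uIcc_of_le (by linarith [mem_Ici.1 ht])]
      exact (ih.mono Icc_subset_Ici_self).integrableOn_Icc
    rw [uIcc_of_le (by linarith [mem_Ici.1 ht])] at h1
    have h2 := h1 t ⟨ht, by linarith⟩
    refine h2.mono_of_mem_nhdsWithin ?_
    rw [← Ici_inter_Iic]
    exact inter_mem_nhdsWithin _ (Iic_mem_nhds (by linarith))

lemma Pfun_succ (hg_c : ContinuousOn g (Ici 0)) (k : ℕ) (t : ℝ) (ht : 0 ≤ t) :
    Pfun g (k+1) t = Acoef g k - ∫ s in (0:ℝ)..t, Pfun g k s := by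
  have hi : IntervalIntegrable (gk g k) volume 0 t := by
    apply ContinuousOn.intervalIntegrable
    rw [uIcc_of_le ht]
    exact (gk_cont hg_c k).mono Icc_subset_Ici_self
  have e : ∫ s in (0:ℝ)..t, Pfun g k s =
      (∑ s : Fin k, ∫ x in (0:ℝ)..t, (-1 : ℝ) ^ (k - 1 - s.1) * Acoef g s.1 * x ^ (k - 1 - s.1) /
    (Nat.factorial (k - 1 - s.1) : ℝ)) + (-1) ^ k * gk g (k+1) t := by
    unfold Pfun
    rw [intervalIntegral.integral_add, intervalIntegral.integral_finsetSum,
      intervalIntegral.integral_const_mul]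
    · rfl
    · intro i _
      apply Continuous.intervalIntegrable
      fun_prop
    · apply Continuous.intervalIntegrable
      fun_prop
    · exact hi.const_mul _
  rw [e]
  unfold Pfun
  rw [Fin.sum_univ_castSucc]
  simp only [Fin.val_castSucc, Fin.val_last, Nat.add_sub_cancel, Nat.sub_self, pow_zero,
    Nat.factorial_zero, Nat.cast_one, one_mul, mul_one, div_one]
  have : ∀ s : Fin k, (-1 : ℝ) ^ (k - s.1) * Acoef g s.1 * t ^ (k - s.1) /
      (Nat.factorial (k - s.1) : ℝ) = - ∫ x in (0:ℝ)..t, (-1 : ℝ) ^ (k - 1 - s.1) *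
        Acoef g s.1 * x ^ (k - 1 - s.1) / (Nat.factorial (k - 1 - s.1) : ℝ) := by
    intro s
    obtain ⟨m, hm⟩ : ∃ m, k - s.1 = m + 1 := ⟨k - s.1 - 1, by have := s.2; omega⟩
    have hm' : k - 1 - s.1 = m := by omega
    rw [hm, hm', intervalIntegral.integral_div, intervalIntegral.integral_const_mul, integral_pow,
      Nat.factorial_succ]
    push_cast
    have : (m.factorial : ℝ) ≠ 0 := by positivity
    have : (m : ℝ) + 1 ≠ 0 := by positivity
    simp only [ne_eq, Nat.add_eq_zero_iff, one_ne_zero, and_false, not_false_eq_true, zero_pow, sub_zero]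
    field_simp
    ring
  rw [Finset.sum_congr rfl (fun s _ => this s), Finset.sum_neg_distrib, pow_succ]
  ring

lemma Acoef_eq (k : ℕ) : Acoef g k = ∫ t in Ioi (0:ℝ), Pfun g k t := by
  cases k with
  | zero => simp [Acoef, Pfun, gk]
  | succ k => rw [Acoef]; rfl

lemma core_lim
    (hg_c : ContinuousOn g (Ici 0))
    (hch : ∀ M, 0 < M → Chain M r (H M))
    (hB : ∀ M, 0 < M → ∀ t ∈ Icc 0 M, |H M r t| ≤ B)
    (k : ℕ) (hk : k + 1 < r)
    (hcont : ∀ M, 0 < M → ContinuousOn (H M k) (Icc 0 M))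
    (hpos : ∀ T, ∀ᶠ M in atTop, ∀ t ∈ Icc 0 T, 0 ≤ H M k t)
    (hpos' : ∀ T, ∀ᶠ M in atTop, ∀ t ∈ Icc 0 T, 0 ≤ H M (k+1) t)
    (hanti : ∀ T, ∀ᶠ M in atTop, AntitoneOn (H M k) (Icc 0 T))
    (hlim : ∀ t, 0 ≤ t → Tendsto (fun M => H M k t) atTop (𝓝 (Pfun g k t))) :
    Tendsto (fun M => H M (k+1) 0) atTop (𝓝 (Acoef g k)) ∧
    ∀ t, 0 ≤ t → Tendsto (fun M => H M (k+1) t) atTop (𝓝 (Pfun g (k+1) t)) := by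
  obtain ⟨j, hj⟩ : ∃ j, r = k + 1 + (j + 1) := ⟨r - k - 2, by omega⟩
  obtain ⟨K, hK, hL⟩ := Chain.landau (j+1)
  have hB0 : 0 ≤ B := (abs_nonneg _).trans (hB 1 one_pos 0 ⟨le_rfl, zero_le_one⟩)
  have Pnn : ∀ t, 0 ≤ t → 0 ≤ Pfun g k t := fun t ht =>
    ge_of_tendsto (hlim t ht) ((hpos t).mono fun M h => h t ⟨ht, le_rfl⟩)
  have Panti : AntitoneOn (Pfun g k) (Ici 0) := by
    intro a ha b hb hab
    refine le_of_tendsto_of_tendsto (hlim b hb) (hlim a ha) ?_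
    filter_upwards [hanti b] with M h
    exact h ⟨ha, hab⟩ ⟨hb, le_rfl⟩ hab
  have Pint : ∀ T, 0 ≤ T → IntervalIntegrable (Pfun g k) volume 0 T := by
    intro T hT
    apply AntitoneOn.intervalIntegrable
    rw [uIcc_of_le hT]
    exact Panti.mono Icc_subset_Ici_self
  have ftc : ∀ T, 0 ≤ T → ∀ᶠ M in atTop,
      ∫ s in (0:ℝ)..T, H M k s = H M (k+1) 0 - H M (k+1) T := by
    intro T hT
    filter_upwards [eventually_gt_atTop 0, eventually_ge_atTop T] with M hM hTM
    have hs : Icc 0 T ⊆ Icc 0 M := Icc_subset_Icc le_rfl hTM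
    have := intervalIntegral.integral_eq_sub_of_hasDerivAt_of_le hT
      (((hch M hM).1 k (by omega)).mono hs)
      (fun t ht => (hch M hM).2 k (by omega) t ⟨ht.1, ht.2.trans_le hTM⟩)
      (ContinuousOn.intervalIntegrable (by rw [uIcc_of_le hT]; exact ((hcont M hM).mono hs).neg))
    rw [intervalIntegral.integral_neg] at this
    linarith
  have conv : ∀ T, 0 ≤ T → Tendsto (fun M => ∫ s in (0:ℝ)..T, H M k s) atTop
      (𝓝 (∫ s in (0:ℝ)..T, Pfun g k s)) := by
    intro T hT
    refine intervalIntegral.tendsto_integral_filter_of_dominated_convergence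
      (fun _ => Pfun g k 0 + 1) ?_ ?_ ?_ ?_
    · filter_upwards [eventually_gt_atTop 0, eventually_ge_atTop T] with M hM hTM
      have hs : Icc 0 T ⊆ Icc 0 M := Icc_subset_Icc le_rfl hTM
      have : IntervalIntegrable (H M k) volume 0 T :=
        ContinuousOn.intervalIntegrable (by rw [uIcc_of_le hT]; exact ((hcont M hM).mono hs))
      rw [intervalIntegrable_iff] at this
      exact this.1
    · have := (hlim 0 le_rfl).eventually_le_const (show Pfun g k 0 < Pfun g k 0 + 1 by linarith)
      filter_upwards [this, hpos T, hanti T] with M h1 h2 h3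
      refine Eventually.of_forall fun t ht => ?_
      rw [uIoc_of_le hT] at ht
      have ht' : t ∈ Icc 0 T := ⟨ht.1.le, ht.2⟩
      rw [Real.norm_eq_abs, abs_of_nonneg (h2 t ht')]
      exact (h3 ⟨le_rfl, hT⟩ ht' ht'.1).trans h1
    · simp
    · refine Eventually.of_forall fun t ht => ?_
      rw [uIoc_of_le hT] at ht
      exact hlim t ht.1.le
  have tail : ∀ T, 1 ≤ T → ∀ᶠ M in atTop, 0 ≤ H M (k+1) T ∧ H M (k+1) T ≤ K * B / T := by
    intro T hT
    filter_upwards [eventually_gt_atTop 0, eventually_ge_atTop T, hpos T, hpos' T]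
      with M hM hTM h1 h2
    have hp := h2 T ⟨by linarith, le_rfl⟩
    refine ⟨hp, ?_⟩
    have ha := (hch M hM).anti (k := k) (by omega) hTM h1
    have h3 := hL M r (H M) (k+1) 0 T (H M (k+1) T) B (hch M hM) (by omega) le_rfl
      (by linarith) hTM hp (fun t ht => ha ht ⟨by linarith, le_rfl⟩ ht.2)
      (fun t ht => by rw [← hj]; exact hB M hM t ⟨ht.1, ht.2.trans hTM⟩)
    rw [sub_zero] at h3
    rw [le_div_iff₀ (by linarith)]
    have h5 : T ≤ T ^ (j+1) := le_self_pow₀ hT (by omega)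
    exact (mul_le_mul_of_nonneg_left h5 hp).trans h3
  have bdd : ∀ T, 1 ≤ T → ∫ s in (0:ℝ)..T, Pfun g k s ≤ (∫ s in (0:ℝ)..1, Pfun g k s) + K * B := by
    intro T hT
    refine le_of_tendsto_of_tendsto (conv T (by linarith))
      ((conv 1 zero_le_one).add_const (K * B)) ?_
    filter_upwards [ftc T (by linarith), ftc 1 zero_le_one, tail T hT, tail 1 le_rfl]
      with M h1 h2 h3 h4
    rw [div_one] at h4
    linarith [h3.1, h4.2]
  have PI : IntegrableOn (Pfun g k) (Ioi 0) := by
    refine integrableOn_Ioi_of_intervalIntegral_norm_bounded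
      ((∫ s in (0:ℝ)..1, Pfun g k s) + K * B) 0 (l := atTop) (b := fun T : ℝ => T) ?_ tendsto_id ?_
    · intro T
      by_cases hT : 0 ≤ T
      · exact (intervalIntegrable_iff_integrableOn_Ioc_of_le hT).1 (Pint T hT)
      · rw [Ioc_eq_empty (by linarith)]; simp
    · filter_upwards [eventually_ge_atTop 1] with T hT
      have : ∫ s in (0:ℝ)..T, ‖Pfun g k s‖ = ∫ s in (0:ℝ)..T, Pfun g k s := by
        apply intervalIntegral.integral_congr
        intro t ht
        rw [uIcc_of_le (by linarith)] at ht
        exact Real.norm_of_nonneg (Pnn t ht.1)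
      rw [this]
      exact bdd T hT
  have Plim := intervalIntegral_tendsto_integral_Ioi 0 PI (tendsto_id (α := ℝ) (x := atTop))
  rw [← Acoef_eq] at Plim
  have D : Tendsto (fun M => H M (k+1) 0) atTop (𝓝 (Acoef g k)) := by
    rw [Metric.tendsto_nhds]
    intro ε hε
    have h1 : ∀ᶠ T : ℝ in atTop, K * B / T < ε / 3 :=
      (tendsto_const_nhds.div_atTop tendsto_id).eventually_lt_const (by positivity)
    have h2 := (Metric.tendsto_nhds.1 Plim) (ε/3) (by positivity)
    obtain ⟨T, h1, h2, hT⟩ := (h1.and (h2.and (eventually_ge_atTop 1))).exists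
    have h3 := (Metric.tendsto_nhds.1 (conv T (by linarith))) (ε/3) (by positivity)
    filter_upwards [h3, tail T hT, ftc T (by linarith)] with M h3 h4 h5
    rw [Real.dist_eq, abs_lt] at h2 h3 ⊢
    simp only [id] at h2
    constructor <;> linarith [h4.1, h4.2, h2.1, h2.2, h3.1, h3.2]
  refine ⟨D, fun t ht => ?_⟩
  rw [Pfun_succ hg_c k t ht]
  refine (D.sub (conv t ht)).congr' ?_
  filter_upwards [ftc t ht] with M h
  rw [h]; ring

lemma core_main
    (hg_c : ContinuousOn g (Ici 0))
    (hg_pos : ∀ t ∈ Ici (0:ℝ), 0 < g t)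
    (hg_anti : AntitoneOn g (Ici 0))
    (hch : ∀ M, 0 < M → Chain M r (H M)) (h0 : ∀ M, 0 < M → H M 0 = g)
    (hB : ∀ M, 0 < M → ∀ t ∈ Icc 0 M, |H M r t| ≤ B)
    (hα : ∀ k, k + 1 < r → ∀ M, 0 < M → α k M ∈ Icc 0 M ∧ H M (k+1) (α k M) = 0 ∧
      ∀ t ∈ Ico 0 (α k M), 0 < H M (k+1) t)
    (k : ℕ) (hk : k + 1 < r) :
    Tendsto (fun M => |H M (k+1) 0|) atTop (𝓝 (Acoef g k)) ∧
    Tendsto (fun M => α k M) atTop atTop := by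
  have hS := core_S hg_pos hg_anti hch h0 hB hα
  have hpos : ∀ k < r, ∀ T, ∀ᶠ M in atTop, ∀ t ∈ Icc 0 T, 0 ≤ H M k t := by
    intro k hk T
    obtain ⟨c, hc, h⟩ := hS k hk T
    exact h.mono fun M h t ht => hc.le.trans (h t ht)
  have hcont : ∀ k < r, ∀ M, 0 < M → ContinuousOn (H M k) (Icc 0 M) := by
    intro k hk M hM
    cases k with
    | zero => rw [h0 M hM]; exact hg_c.mono Icc_subset_Ici_self
    | succ k => exact (hch M hM).1 k (by omega)
  have hanti : ∀ k < r, ∀ T, ∀ᶠ M in atTop, AntitoneOn (H M k) (Icc 0 T) := by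
    intro k hk T
    cases k with
    | zero =>
      filter_upwards [eventually_gt_atTop 0] with M hM
      rw [h0 M hM]; exact hg_anti.mono Icc_subset_Ici_self
    | succ k =>
      filter_upwards [eventually_gt_atTop 0, eventually_ge_atTop T, hpos k (by omega) T]
        with M hM hT h
      exact (hch M hM).anti (by omega) hT h
  have hl : ∀ k < r, ∀ t, 0 ≤ t → Tendsto (fun M => H M k t) atTop (𝓝 (Pfun g k t)) := by
    intro k
    induction k with
    | zero =>
      intro _ t _
      refine tendsto_const_nhds.congr' ?_
      filter_upwards [eventually_gt_atTop 0] with M hM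
      rw [h0 M hM]; simp [Pfun, gk]
    | succ k ih =>
      intro hk
      exact (core_lim hg_c hch hB k hk (hcont k (by omega)) (hpos k (by omega)) (hpos (k+1) hk)
        (hanti k (by omega)) (ih (by omega))).2
  constructor
  · refine (core_lim hg_c hch hB k hk (hcont k (by omega)) (hpos k (by omega)) (hpos (k+1) hk)
        (hanti k (by omega)) (hl k (by omega))).1.congr' ?_
    filter_upwards [hpos (k+1) hk 0] with M h
    rw [abs_of_nonneg (h 0 ⟨le_rfl, le_rfl⟩)]
  · exact core_alpha hch hB k hk (fun M hM => ⟨(hα k hk M hM).1, (hα k hk M hM).2.1⟩)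
      (hS k (by omega))
end core

noncomputable def spH (g : ℝ → ℝ) (r : ℕ) (ε M : ℝ) (G : ℝ → ℝ) : ℕ → ℝ → ℝ
  | 0 => fun t => ε * g t
  | k + 1 => fun t => (-1) ^ (k + 1) * iteratedDerivWithin (r - (k + 1)) G (Icc 0 M) t

lemma spH_chain {g : ℝ → ℝ} {r : ℕ} {ε M : ℝ} {G : ℝ → ℝ} (hr : 2 ≤ r) (hM : 0 < M)
    (h1 : ContDiffOn ℝ (r - 1 : ℕ) G (Icc 0 M))
    (h2 : ContDiffOn ℝ (r : ℕ) G (Ioo 0 M))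
    (h3 : ∀ s ∈ Ioo 0 M, iteratedDerivWithin r G (Ioo 0 M) s = ε * g s) :
    Chain M r (spH g r ε M G) := by
  have hu := uniqueDiffOn_Icc hM
  constructor
  · intro k hk
    apply ContinuousOn.mul continuousOn_const
    exact h1.continuousOn_iteratedDerivWithin (by exact_mod_cast (by omega)) hu
  · intro k hk t ht
    have hn : Icc 0 M ∈ 𝓝 t := Icc_mem_nhds ht.1 ht.2
    cases k with
    | zero =>
      obtain ⟨q, rfl⟩ : ∃ q, r = q + 1 := ⟨r - 1, by omega⟩
      have hd := (h2.differentiableOn_iteratedDerivWithin (m := q)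
        (by exact_mod_cast (by omega)) isOpen_Ioo.uniqueDiffOn) t ht
      have hd2 := hd.hasDerivWithinAt.hasDerivAt (isOpen_Ioo.mem_nhds ht)
      rw [← iteratedDerivWithin_succ, h3 t ht] at hd2
      have he : iteratedDerivWithin q G (Icc 0 M) =ᶠ[𝓝 t] iteratedDerivWithin q G (Ioo 0 M) := by
        filter_upwards [isOpen_Ioo.mem_nhds ht] with s hs
        unfold iteratedDerivWithin
        rw [iteratedFDerivWithin_congr_set]
        filter_upwards [isOpen_Ioo.mem_nhds hs] with x hx
        exact propext ⟨fun _ => hx, fun _ => ⟨hx.1.le, hx.2.le⟩⟩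
      have := (hd2.congr_of_eventuallyEq he).const_mul ((-1 : ℝ) ^ (0 + 1))
      refine this.congr_deriv ?_
      simp [spH]
    | succ k =>
      obtain ⟨q, hq⟩ : ∃ q, r - (k + 1 + 1) = q := ⟨_, rfl⟩
      have hq' : r - (k + 1) = q + 1 := by omega
      have hd := (h1.differentiableOn_iteratedDerivWithin (m := q)
        (by exact_mod_cast (by omega)) hu) t ⟨ht.1.le, ht.2.le⟩
      have hd2 := hd.hasDerivWithinAt.hasDerivAt hn
      rw [← iteratedDerivWithin_succ] at hd2
      simp only [spH, hq, hq']
      refine (hd2.const_mul ((-1 : ℝ) ^ (k + 1 + 1))).congr_deriv ?_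
      ring

lemma spH_top {g : ℝ → ℝ} {r : ℕ} {ε M : ℝ} {G : ℝ → ℝ} (hr : 2 ≤ r) (t : ℝ) :
    spH g r ε M G r t = (-1) ^ r * G t := by
  obtain ⟨q, rfl⟩ : ∃ q, r = q + 1 := ⟨r - 1, by omega⟩
  simp [spH]

lemma wNorm_ge {f G : ℝ → ℝ} {M : ℝ} (hf_c : ContinuousOn f (Ici 0))
    (hf_pos : ∀ t ∈ Ici (0:ℝ), 0 < f t) (hG : ContinuousOn G (Icc 0 M)) (t : ℝ)
    (ht : t ∈ Icc 0 M) : |G t| ≤ wNorm G f (Icc 0 M) * f t := by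
  rw [← div_le_iff₀ (hf_pos t ht.1)]
  refine le_csSup ?_ ⟨t, ht, rfl⟩
  apply IsCompact.bddAbove_image isCompact_Icc
  exact hG.abs.div (hf_c.mono Icc_subset_Ici_self) (fun t ht => (hf_pos t ht.1).ne')

lemma extremal_facts {f g : ℝ → ℝ} {r : ℕ} {M : ℝ} {G : ℝ → ℝ}
    (hf_c : ContinuousOn f (Ici 0)) (hf_pos : ∀ t ∈ Ici (0:ℝ), 0 < f t)
    (hg_pos : ∀ t ∈ Ici (0:ℝ), 0 < g t)
    (hg_anti : AntitoneOn g (Ici 0))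
    (hr : 2 ≤ r) (hM : 0 < M) (h : IsExtremalSpline f g r 0 M G) :
    ContinuousOn G (Icc 0 M) ∧ Chain M r (spH g r 1 M G) ∧ 0 < wNorm G f (Icc 0 M) ∧
    ∃ x : ℕ → ℝ, (∀ i ≤ r, x i ∈ Icc 0 M) ∧ (∀ i < r, x i < x (i+1)) ∧
    ∀ i ≤ r, spH g r 1 M G r (x i) = (-1) ^ i * (wNorm G f (Icc 0 M) * f (x i)) := by
  obtain ⟨⟨m, hm, u, ε, hε, hu0, hu1, -, h1, h2⟩, b, hb1, hbM, hblt, hbv⟩ := h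
  obtain rfl : m = 0 := by omega
  obtain ⟨h2, h3⟩ := h2 0 le_rfl
  rw [hu0, hu1] at h2 h3
  simp only [pow_zero, mul_one] at h3
  have hG := h1.continuousOn
  have hch := spH_chain hr hM h1 h2 h3
  have hbnd := wNorm_ge hf_c hf_pos hG
  set l := wNorm G f (Icc 0 M) with hl
  have hl0 : 0 ≤ l := by
    have := (abs_nonneg _).trans (hbnd 0 ⟨le_rfl, hM.le⟩)
    exact nonneg_of_mul_nonneg_left this (hf_pos 0 self_mem_Ici)
  have hlpos : 0 < l := by
    rcases hl0.eq_or_lt with e | e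
    · exfalso
      obtain ⟨K, hK, hL⟩ := Chain.landau r
      have hz : ∀ t ∈ Icc 0 M, G t = 0 := by
        intro t ht
        have := hbnd t ht
        rw [← e, zero_mul] at this
        exact abs_nonpos_iff.1 this
      have hgM := hg_pos M hM.le
      have hgl : ∀ t ∈ Icc 0 M, g M ≤ g t := fun t ht => hg_anti ht.1 hM.le ht.2
      have hcon : g M * (M - 0) ^ r ≤ K * 0 := by
        rcases hε with rfl | rfl
        · refine hL M r _ 0 0 M (g M) 0 hch (by omega) le_rfl hM.le le_rfl hgM.le ?_ ?_
          · intro t ht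
            simpa [spH] using hgl t ht
          · intro t ht
            rw [zero_add, spH_top hr, hz t ht]; simp
        · refine hL M r _ 0 0 M (g M) 0 hch.neg (by omega) le_rfl hM.le le_rfl hgM.le ?_ ?_
          · intro t ht
            simpa [spH] using hgl t ht
          · intro t ht
            rw [zero_add, spH_top hr, hz t ht]; simp
      have : 0 < g M * (M - 0) ^ r := by rw [sub_zero]; positivity
      linarith
    · exact e
  have hmono : ∀ i ≤ r, b 1 ≤ b (i+1) := by
    intro i
    induction i with
    | zero => simp
    | succ i ih =>
      intro hi
      exact (ih (by omega)).trans (hblt (i+1) (by omega) (by omega)).le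
  have hmono' : ∀ j ≤ r, b (r - j + 1) ≤ M := by
    intro j
    induction j with
    | zero => intro _; rw [← hbM]; simp
    | succ j ih =>
      intro hj
      have := hblt (r - (j+1) + 1) (by omega) (by omega)
      have e : r - (j + 1) + 1 + 1 = r - j + 1 := by omega
      rw [e] at this
      exact this.le.trans (ih (by omega))
  have hx : ∀ i ≤ r, b (i+1) ∈ Icc 0 M := by
    intro i hi
    refine ⟨hb1.trans (hmono i hi), ?_⟩
    have := hmono' (r - i) (by omega)
    rwa [show r - (r - i) = i by omega] at this
  have hv : ∀ i ≤ r, ∀ ε', spH g r ε' M G r (b (i+1)) = (-1) ^ i * (l * f (b (i+1))) := by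
    intro i hi ε'
    rw [spH_top hr, hbv (i+1) (by omega) (by omega), ← mul_assoc, ← pow_add]
    congr 1
    rw [show r + (i + 1 + r + 1) = i + 2 * (r + 1) by ring, pow_add, pow_mul]
    simp
  have hlt : ∀ i < r, b (i+1) < b (i+1+1) := fun i hi => hblt (i+1) (by omega) (by omega)
  have hε1 : ε = 1 := by
    have : Alt M (spH g r ε M G) 0 0 1 := by
      apply hch.alt_down 1 r (by omega)
      rw [zero_add]
      refine ⟨fun i => b (i+1), hx, hlt, fun i hi => ?_⟩
      rw [hv i hi, mul_one, ← mul_assoc, ← mul_pow]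
      have := hf_pos _ (hx i hi).1
      simp only [mul_neg, mul_one, neg_neg, one_pow, one_mul]
      positivity
    obtain ⟨x, hx, -, hs⟩ := this
    have h0 := hs 0 le_rfl
    have hg0 := hg_pos _ (hx 0 le_rfl).1
    rcases hε with rfl | rfl
    · rfl
    · simp [spH] at h0
      linarith
  subst hε1
  exact ⟨hG, hch, hlpos, fun i => b (i+1), hx, hlt, fun i hi => hv i hi 1⟩

lemma norm_unique {f g : ℝ → ℝ} {r : ℕ} {M : ℝ} {G G' : ℝ → ℝ}
    (hf_c : ContinuousOn f (Ici 0)) (hf_pos : ∀ t ∈ Ici (0:ℝ), 0 < f t)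
    (hg_pos : ∀ t ∈ Ici (0:ℝ), 0 < g t)
    (hg_anti : AntitoneOn g (Ici 0))
    (hr : 2 ≤ r) (hM : 0 < M) (h : IsExtremalSpline f g r 0 M G)
    (h' : IsExtremalSpline f g r 0 M G') : wNorm G f (Icc 0 M) ≤ wNorm G' f (Icc 0 M) := by
  obtain ⟨-, hc, -, x, hx, hlt, hv⟩ := extremal_facts hf_c hf_pos hg_pos hg_anti hr hM h
  obtain ⟨hG', hc', -, -⟩ := extremal_facts hf_c hf_pos hg_pos hg_anti hr hM h'
  by_contra hn
  push Not at hn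
  have : Alt M (fun k t => spH g r 1 M G k t - spH g r 1 M G' k t) 0 0 1 := by
    apply (hc.sub hc').alt_down 1 r (by omega)
    rw [zero_add]
    refine ⟨x, hx, hlt, fun i hi => ?_⟩
    beta_reduce
    rw [hv i hi, mul_one, spH_top hr, mul_sub, ← mul_assoc, ← mul_pow]
    have hf := hf_pos _ (hx i hi).1
    have h1 := wNorm_ge hf_c hf_pos hG' (x i) (hx i hi)
    have h2 := mul_lt_mul_of_pos_right hn hf
    have h3 := le_abs_self ((-1) ^ i * ((-1) ^ r * G' (x i)))
    rw [abs_mul, abs_mul, abs_pow, abs_pow] at h3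
    simp only [mul_neg, mul_one, neg_neg, one_pow, one_mul, abs_neg, abs_one] at h3 ⊢
    linarith
  obtain ⟨x, hx, -, hs⟩ := this
  have h0 := hs 0 le_rfl
  simp [spH] at h0

/-- Lemma 4: if r ≥ 2 and φ_{r,0,f}(∞) < ∞ then |G_{r,0,f,M}^{(r-k-1)}(0)| → A_k and
α_{k+1}^M → ∞ as M → ∞, for k = 0, 1, …, r-2, where α_{k+1}^M is the first zero of
G_{r,0,f,M}^{(r-k-1)}. -/
theorem statement10
    (f g : ℝ → ℝ)
    (hf_c : ContinuousOn f (Ici 0)) (hf_pos : ∀ t ∈ Ici (0:ℝ), 0 < f t)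
    (hf_anti : AntitoneOn f (Ici 0))
    (hg_c : ContinuousOn g (Ici 0)) (hg_pos : ∀ t ∈ Ici (0:ℝ), 0 < g t)
    (hg_anti : AntitoneOn g (Ici 0))
    (r : ℕ) (hr : 2 ≤ r)
    (φ0 : ℝ → ℝ)
    (hφ0 : ∀ a, 0 < a → ∃ G : ℝ → ℝ,
      IsExtremalSpline f g r 0 a G ∧ φ0 a = wNorm G f (Icc 0 a))
    (hfin : ∃ C, ∀ a, 0 < a → φ0 a ≤ C)
    (GM : ℝ → ℝ → ℝ) (hGM : ∀ M, 0 < M → IsExtremalSpline f g r 0 M (GM M))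
    (α : ℕ → ℝ → ℝ)
    (hα : ∀ k, k ≤ r - 2 → ∀ M, 0 < M →
      IsLeast {t ∈ Icc (0:ℝ) M |
        iteratedDerivWithin (r - k - 1) (GM M) (Icc 0 M) t = 0} (α k M)) :
    ∀ k, k ≤ r - 2 →
      Tendsto (fun M => |iteratedDerivWithin (r - k - 1) (GM M) (Icc 0 M) 0|)
        atTop (nhds (Acoef g k)) ∧
      Tendsto (fun M => α k M) atTop atTop := by
  obtain ⟨C, hC⟩ := hfin
  have facts := fun M hM => extremal_facts hf_c hf_pos hg_pos hg_anti hr hM (hGM M hM)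
  have hchain : ∀ M, 0 < M → Chain M r (spH g r 1 M (GM M)) := fun M hM => (facts M hM).2.1
  have h0 : ∀ M, 0 < M → spH g r 1 M (GM M) 0 = g := by
    intro M hM
    funext t
    simp [spH]
  have hB : ∀ M, 0 < M → ∀ t ∈ Icc 0 M, |spH g r 1 M (GM M) r t| ≤ C * f 0 := by
    intro M hM t ht
    obtain ⟨hG, -, hl, -⟩ := facts M hM
    rw [spH_top hr, abs_mul, abs_pow, abs_neg, abs_one, one_pow, one_mul]
    obtain ⟨G', hG', e⟩ := hφ0 M hM
    have h1 := norm_unique hf_c hf_pos hg_pos hg_anti hr hM (hGM M hM) hG'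
    have h2 := hC M hM
    have h3 : wNorm (GM M) f (Icc 0 M) ≤ C := by linarith
    have h4 := hf_anti self_mem_Ici ht.1 ht.1
    exact (wNorm_ge hf_c hf_pos hG t ht).trans
      (mul_le_mul h3 h4 (hf_pos t ht.1).le (hl.le.trans h3))
  have hset : ∀ k M t, spH g r 1 M (GM M) (k+1) t = 0 ↔
      iteratedDerivWithin (r - k - 1) (GM M) (Icc 0 M) t = 0 := by
    intro k M t
    rw [Nat.sub_sub]
    simp [spH]
  intro k hk
  have hmain := core_main (H := fun M => spH g r 1 M (GM M)) (α := α) hg_c hg_pos hg_anti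
    hchain h0 hB ?_ k (by omega)
  · refine ⟨?_, hmain.2⟩
    refine hmain.1.congr fun M => ?_
    rw [Nat.sub_sub]
    simp [spH, abs_mul]
  · intro k hk M hM
    have hl := hα k (by omega) M hM
    simp only [← hset] at hl
    refine ⟨hl.1.1, hl.1.2, ?_⟩
    obtain ⟨-, hc, hlp, x, hx, hlt, hv⟩ := facts M hM
    refine hc.first_zero ?_ ⟨x, hx, hlt, fun i hi => ?_⟩ k (by omega) _ hl
    · intro t ht
      rw [h0 M hM]
      exact hg_pos t ht.1
    · rw [hv i hi, mul_one, ← mul_assoc, ← mul_pow]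
      have := hf_pos _ (hx i hi).1
      simp only [mul_neg, mul_one, neg_neg, one_pow, one_mul]
      positivity
end

section
/- Let f and g be continuous, positive, non-increasing functions on [0,∞), let r ∈ ℕ, and assume φ_{r,0,f}(∞) < ∞ and f(t) → 0 as t → ∞. For M > 0 let G_M := G_{r,0,f,M} be the perfect g-spline with no knots on [0, M] having r+1 oscillation points. Then |G_M(0)| → A_{r−1} as M → ∞. -/
open Set Filter MeasureTheory
open scoped Topology

noncomputable def Fk (e : ℕ → ℝ) (g : ℝ → ℝ) : ℕ → ℝ → ℝ
  | 0 => g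
  | k + 1 => fun t => e k + ∫ s in (0:ℝ)..t, Fk e g k s

lemma Fk_zero_eq_gk (g : ℝ → ℝ) (k : ℕ) : Fk (fun _ => 0) g k = gk g k := by
  induction k with
  | zero => rfl
  | succ k ih => funext t; simp only [Fk, gk, ih, zero_add]

lemma cont_ii {F : ℝ → ℝ} (hF : ContinuousOn F (Ici 0)) {a b : ℝ} (ha : 0 ≤ a) (hb : 0 ≤ b) :
    IntervalIntegrable F volume a b := by
  apply ContinuousOn.intervalIntegrable
  apply hF.mono
  intro x hx
  exact le_trans (le_min ha hb) hx.1

lemma Fk_cont (e : ℕ → ℝ) {g : ℝ → ℝ} (hg : ContinuousOn g (Ici 0)) (k : ℕ) :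
    ContinuousOn (Fk e g k) (Ici 0) := by
  induction k with
  | zero => exact hg
  | succ k ih =>
    intro t ht
    have ht0 : (0:ℝ) ≤ t := ht
    have h1 : IntegrableOn (Fk e g k) (uIcc 0 (t+1)) := by
      apply ContinuousOn.integrableOn_uIcc
      apply ih.mono
      rw [uIcc_of_le (by linarith)]
      exact Icc_subset_Ici_self
    have h2 := intervalIntegral.continuousOn_primitive_interval h1
    rw [uIcc_of_le (by linarith)] at h2
    have h3 := (h2 t ⟨ht0, by linarith⟩)
    have h4 : ContinuousWithinAt (fun x => ∫ s in (0:ℝ)..x, Fk e g k s) (Ici 0) t := by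
      apply h3.mono_of_mem_nhdsWithin
      rw [← Ici_inter_Iic]
      exact inter_mem_nhdsWithin _ (Iic_mem_nhds (by linarith))
    exact continuousWithinAt_const.add h4

lemma Fk_deriv (e : ℕ → ℝ) {g : ℝ → ℝ} (hg : ContinuousOn g (Ici 0)) (k : ℕ) {t : ℝ} (ht : 0 < t) :
    HasDerivAt (Fk e g (k+1)) (Fk e g k t) t := by
  have hc := Fk_cont e hg k
  have h := intervalIntegral.integral_hasDerivAt_right (cont_ii hc le_rfl ht.le)
    (ContinuousOn.stronglyMeasurableAtFilter isOpen_Ioi (hc.mono Ioi_subset_Ici_self) t ht)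
    ((hc t ht.le).continuousAt (Ici_mem_nhds ht))
  exact h.const_add (e k)

lemma Fk_at_zero (e : ℕ → ℝ) (g : ℝ → ℝ) (k : ℕ) : Fk e g (k+1) 0 = e k := by
  simp [Fk]

lemma Fk_closed (e : ℕ → ℝ) {g : ℝ → ℝ} (hg : ContinuousOn g (Ici 0)) (k : ℕ) {t : ℝ} (ht : 0 ≤ t) :
    Fk e g k t = (∑ s ∈ Finset.range k, e s * t ^ (k - 1 - s) / (Nat.factorial (k - 1 - s) : ℝ))
      + gk g k t := by
  induction k generalizing t with
  | zero => simp [Fk, gk]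
  | succ k ih =>
    have h1 : ∫ s in (0:ℝ)..t, Fk e g k s = ∫ s in (0:ℝ)..t,
        ((∑ i ∈ Finset.range k, e i * s ^ (k - 1 - i) / (Nat.factorial (k - 1 - i) : ℝ))
      + gk g k s) := by
      apply intervalIntegral.integral_congr
      intro s hs
      rw [uIcc_of_le ht] at hs
      exact ih hs.1
    have hgk : ContinuousOn (gk g k) (Ici 0) := by
      rw [← Fk_zero_eq_gk]; exact Fk_cont _ hg k
    simp only [Fk, gk, h1]
    rw [intervalIntegral.integral_add, intervalIntegral.integral_finsetSum, Finset.sum_range_succ]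
    · have h2 : ∀ i ∈ Finset.range k,
          ∫ s in (0:ℝ)..t, e i * s ^ (k - 1 - i) / (Nat.factorial (k - 1 - i) : ℝ) =
          e i * t ^ (k + 1 - 1 - i) / (Nat.factorial (k + 1 - 1 - i) : ℝ) := by
        intro i hi
        have hi' := Finset.mem_range.1 hi
        obtain ⟨m, rfl⟩ : ∃ m, k = i + 1 + m := ⟨k - (i+1), by omega⟩
        have e1 : i + 1 + m - 1 - i = m := by omega
        have e2 : i + 1 + m + 1 - 1 - i = m + 1 := by omega
        rw [e1, e2, intervalIntegral.integral_div, intervalIntegral.integral_const_mul, integral_pow]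
        rw [Nat.factorial_succ]
        push_cast
        have : (Nat.factorial m : ℝ) ≠ 0 := by positivity
        have : (m : ℝ) + 1 ≠ 0 := by positivity
        field_simp
        simp
      rw [Finset.sum_congr rfl h2]
      simp
      ring
    · intro i _
      apply Continuous.intervalIntegrable
      fun_prop
    · apply Continuous.intervalIntegrable
      fun_prop
    · exact cont_ii hgk le_rfl ht

lemma mono_tendsto {F F' : ℝ → ℝ} (hd : ∀ t, 0 < t → HasDerivAt F (F' t) t) {T : ℝ}
    (hm : MonotoneOn F' (Ici T)) (hF : Tendsto F atTop (𝓝 0)) : Tendsto F' atTop (𝓝 0) := by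
  have h1 : Tendsto (fun t => F (t+1) - F t) atTop (𝓝 0) := by
    simpa using (hF.comp (tendsto_atTop_add_const_right atTop (1:ℝ) tendsto_id)).sub hF
  have h2 : Tendsto (fun t => F t - F (t-1)) atTop (𝓝 0) := by
    simpa [sub_eq_add_neg] using hF.sub (hF.comp (tendsto_atTop_add_const_right atTop (-1:ℝ) tendsto_id))
  have mv : ∀ a : ℝ, 0 < a → ∃ c ∈ Ioo a (a+1), F' c = F (a+1) - F a := by
    intro a ha
    obtain ⟨c, hc, h⟩ := exists_hasDerivAt_eq_slope F F' (show a < a + 1 by linarith)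
      (fun x hx => (hd x (lt_of_lt_of_le ha hx.1)).continuousAt.continuousWithinAt)
      (fun x hx => hd x (lt_trans ha hx.1))
    exact ⟨c, hc, by rw [h]; simp⟩
  refine tendsto_of_tendsto_of_tendsto_of_le_of_le' h2 h1 ?_ ?_
  · filter_upwards [eventually_gt_atTop (T+1), eventually_gt_atTop 1] with t ht ht1
    obtain ⟨c, hc, h⟩ := mv (t-1) (by linarith)
    rw [sub_add_cancel] at h hc
    rw [← h]
    exact hm (show T ≤ c by linarith [hc.1]) (show T ≤ t by linarith) hc.2.le
  · filter_upwards [eventually_gt_atTop T, eventually_gt_atTop 0] with t ht ht1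
    obtain ⟨c, hc, h⟩ := mv t ht1
    rw [← h]
    exact hm (show T ≤ t from ht.le) (show T ≤ c by linarith [hc.1]) hc.1.le

lemma anti_tendsto {F F' : ℝ → ℝ} (hd : ∀ t, 0 < t → HasDerivAt F (F' t) t) {T : ℝ}
    (hm : AntitoneOn F' (Ici T)) (hF : Tendsto F atTop (𝓝 0)) : Tendsto F' atTop (𝓝 0) := by
  have h := mono_tendsto (F := fun t => - F t) (F' := fun t => - F' t) (T := T)
    (fun t ht => (hd t ht).neg) (fun x hx y hy hxy => neg_le_neg (hm hx hy hxy))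
    (by simpa using hF.neg)
  simpa using h.neg

lemma Fk_mono_of_sign (e : ℕ → ℝ) {g : ℝ → ℝ} (hg : ContinuousOn g (Ici 0)) (k : ℕ) {T : ℝ}
    (hT : 0 ≤ T) (h : ∀ t, T ≤ t → 0 ≤ Fk e g k t) : MonotoneOn (Fk e g (k+1)) (Ici T) := by
  apply monotoneOn_of_deriv_nonneg (convex_Ici T)
    ((Fk_cont e hg (k+1)).mono (Ici_subset_Ici.2 hT))
  · intro x hx
    rw [interior_Ici] at hx
    exact (Fk_deriv e hg k (lt_of_le_of_lt hT hx)).differentiableAt.differentiableWithinAt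
  · intro x hx
    rw [interior_Ici] at hx
    rw [(Fk_deriv e hg k (lt_of_le_of_lt hT hx)).deriv]
    exact h x (le_of_lt hx)

lemma Fk_anti_of_sign (e : ℕ → ℝ) {g : ℝ → ℝ} (hg : ContinuousOn g (Ici 0)) (k : ℕ) {T : ℝ}
    (hT : 0 ≤ T) (h : ∀ t, T ≤ t → Fk e g k t ≤ 0) : AntitoneOn (Fk e g (k+1)) (Ici T) := by
  apply antitoneOn_of_deriv_nonpos (convex_Ici T)
    ((Fk_cont e hg (k+1)).mono (Ici_subset_Ici.2 hT))
  · intro x hx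
    rw [interior_Ici] at hx
    exact (Fk_deriv e hg k (lt_of_le_of_lt hT hx)).differentiableAt.differentiableWithinAt
  · intro x hx
    rw [interior_Ici] at hx
    rw [(Fk_deriv e hg k (lt_of_le_of_lt hT hx)).deriv]
    exact h x (le_of_lt hx)

lemma ev_mono (e : ℕ → ℝ) {g : ℝ → ℝ} (hg : ContinuousOn g (Ici 0)) (hga : AntitoneOn g (Ici 0))
    (k : ℕ) : ∃ T : ℝ, 0 ≤ T ∧ (MonotoneOn (Fk e g k) (Ici T) ∨ AntitoneOn (Fk e g k) (Ici T)) := by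
  induction k with
  | zero => exact ⟨0, le_rfl, Or.inr hga⟩
  | succ k ih =>
    obtain ⟨T, hT, h⟩ := ih
    have hs : ∃ T', 0 ≤ T' ∧ ((∀ t, T' ≤ t → 0 ≤ Fk e g k t) ∨ (∀ t, T' ≤ t → Fk e g k t ≤ 0)) := by
      rcases h with h | h
      · by_cases hx : ∃ t, T ≤ t ∧ 0 ≤ Fk e g k t
        · obtain ⟨t, ht, h0⟩ := hx
          exact ⟨t, hT.trans ht, Or.inl fun s hs => h0.trans (h ht (ht.trans hs) hs)⟩
        · push Not at hx
          exact ⟨T, hT, Or.inr fun s hs => (hx s hs).le⟩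
      · by_cases hx : ∃ t, T ≤ t ∧ Fk e g k t ≤ 0
        · obtain ⟨t, ht, h0⟩ := hx
          exact ⟨t, hT.trans ht, Or.inr fun s hs => (h ht (ht.trans hs) hs).trans h0⟩
        · push Not at hx
          exact ⟨T, hT, Or.inl fun s hs => (hx s hs).le⟩
    obtain ⟨T', hT', h'⟩ := hs
    refine ⟨T', hT', ?_⟩
    rcases h' with h' | h'
    · exact Or.inl (Fk_mono_of_sign e hg k hT' h')
    · exact Or.inr (Fk_anti_of_sign e hg k hT' h')

lemma Fk_tendsto (e : ℕ → ℝ) {g : ℝ → ℝ} (hg : ContinuousOn g (Ici 0))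
    (hga : AntitoneOn g (Ici 0)) (r : ℕ) (hr : Tendsto (Fk e g r) atTop (𝓝 0)) :
    ∀ j ≤ r, Tendsto (Fk e g (r - j)) atTop (𝓝 0) := by
  intro j
  induction j with
  | zero => intro _; exact hr
  | succ j ih =>
    intro hj
    have h := ih (by omega)
    have e1 : r - j = (r - (j+1)) + 1 := by omega
    rw [e1] at h
    obtain ⟨T, hT, h'⟩ := ev_mono e hg hga (r - (j+1))
    rcases h' with h' | h'
    · exact mono_tendsto (fun t ht => Fk_deriv e hg _ ht) h' h
    · exact anti_tendsto (fun t ht => Fk_deriv e hg _ ht) h' h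

lemma Fk_tendsto' (e : ℕ → ℝ) {g : ℝ → ℝ} (hg : ContinuousOn g (Ici 0))
    (hga : AntitoneOn g (Ici 0)) (r : ℕ) (hr : Tendsto (Fk e g r) atTop (𝓝 0)) :
    ∀ k ≤ r, Tendsto (Fk e g k) atTop (𝓝 0) := by
  intro k hk
  have := Fk_tendsto e hg hga r hr (r - k) (by omega)
  rwa [show r - (r - k) = k by omega] at this

lemma Fk_W (e : ℕ → ℝ) {g : ℝ → ℝ} (hg : ContinuousOn g (Ici 0)) (k : ℕ)
    (hs : ∀ t, 0 ≤ t → 0 ≤ (-1:ℝ)^k * Fk e g k t) (h : Tendsto (Fk e g (k+1)) atTop (𝓝 0)) :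
    (∀ t, 0 ≤ t → 0 ≤ (-1:ℝ)^(k+1) * Fk e g (k+1) t) := by
  intro t ht
  have hm : MonotoneOn (fun t => (-1:ℝ)^k * Fk e g (k+1) t) (Ici 0) := by
    apply monotoneOn_of_deriv_nonneg (convex_Ici 0)
      (continuousOn_const.mul (Fk_cont e hg (k+1)))
    · intro x hx
      rw [interior_Ici] at hx
      exact ((Fk_deriv e hg k hx).const_mul _).differentiableAt.differentiableWithinAt
    · intro x hx
      rw [interior_Ici] at hx
      have hd := ((Fk_deriv e hg k hx).const_mul ((-1:ℝ)^k)).deriv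
      refine le_of_le_of_eq ?_ hd.symm
      exact hs x (le_of_lt hx)
  have h0 : Tendsto (fun t => (-1:ℝ)^k * Fk e g (k+1) t) atTop (𝓝 0) := by
    simpa using h.const_mul ((-1:ℝ)^k)
  have : (-1:ℝ)^k * Fk e g (k+1) t ≤ 0 := by
    apply ge_of_tendsto h0
    filter_upwards [eventually_ge_atTop t] with s hs
    exact hm ht (ht.trans hs) hs
  rw [pow_succ]
  linarith

lemma Fk_sign (e : ℕ → ℝ) {g : ℝ → ℝ} (hg : ContinuousOn g (Ici 0))
    (hgp : ∀ t ∈ Ici (0:ℝ), 0 < g t) (r : ℕ) (ht : ∀ k ≤ r, Tendsto (Fk e g k) atTop (𝓝 0)) :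
    ∀ k ≤ r, ∀ t, 0 ≤ t → 0 ≤ (-1:ℝ)^k * Fk e g k t := by
  intro k
  induction k with
  | zero => intro _ t ht; simpa [Fk] using (hgp t ht).le
  | succ k ih => intro hk; exact Fk_W e hg k (ih (by omega)) (ht _ hk)

lemma Fk_int (e : ℕ → ℝ) {g : ℝ → ℝ} (hg : ContinuousOn g (Ici 0)) (k : ℕ)
    (hs : ∀ t, 0 ≤ t → 0 ≤ (-1:ℝ)^k * Fk e g k t) (h : Tendsto (Fk e g (k+1)) atTop (𝓝 0)) :
    ∫ t in Ioi (0:ℝ), (-1:ℝ)^k * Fk e g k t = (-1)^(k+1) * e k := by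
  have h0 : Tendsto (fun t => (-1:ℝ)^k * Fk e g (k+1) t) atTop (𝓝 0) := by
    simpa using h.const_mul ((-1:ℝ)^k)
  have := integral_Ioi_of_hasDerivAt_of_nonneg
    (g := fun t => (-1:ℝ)^k * Fk e g (k+1) t) (g' := fun t => (-1:ℝ)^k * Fk e g k t) (a := 0)
    ((continuousOn_const.mul (Fk_cont e hg (k+1))) 0 (le_refl (0:ℝ)))
    (fun x hx => (Fk_deriv e hg k hx).const_mul _) (fun x hx => hs x (le_of_lt hx)) h0
  rw [this, Fk_at_zero, pow_succ]
  ring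

lemma Acoef_eq_s11 (e : ℕ → ℝ) {g : ℝ → ℝ} (hg : ContinuousOn g (Ici 0))
    (hgp : ∀ t ∈ Ici (0:ℝ), 0 < g t) (r : ℕ) (ht : ∀ k ≤ r, Tendsto (Fk e g k) atTop (𝓝 0)) :
    ∀ k < r, Acoef g k = (-1)^(k+1) * e k := by
  intro k
  induction k using Nat.strong_induction_on with
  | _ k ih =>
    intro hk
    rw [← Fk_int e hg k (Fk_sign e hg hgp r ht k hk.le) (ht _ hk)]
    cases k with
    | zero => simp [Acoef, Fk]
    | succ k =>
      rw [Acoef]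
      apply setIntegral_congr_fun measurableSet_Ioi
      intro t ht0
      have ht0' : (0:ℝ) ≤ t := le_of_lt ht0
      simp only
      rw [Fk_closed e hg (k+1) ht0', mul_add, Finset.mul_sum,
        ← Fin.sum_univ_eq_sum_range (fun s => (-1:ℝ)^(k+1) *
          (e s * t ^ (k + 1 - 1 - s) / (Nat.factorial (k + 1 - 1 - s) : ℝ)))]
      congr 1
      apply Finset.sum_congr rfl
      intro s _
      rw [ih s.1 s.2 (by omega), Nat.add_sub_cancel]
      have : (-1:ℝ)^(k+1) = (-1)^(k - s.1) * (-1)^(s.1+1) := by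
        rw [← pow_add]; congr 1; omega
      rw [this]; ring

lemma A_abs (e : ℕ → ℝ) {g : ℝ → ℝ} (hg : ContinuousOn g (Ici 0))
    (hga : AntitoneOn g (Ici 0))
    (hgp : ∀ t ∈ Ici (0:ℝ), 0 < g t) (r : ℕ) (hr : Tendsto (Fk e g (r+1)) atTop (𝓝 0)) :
    |Fk e g (r+1) 0| = Acoef g r := by
  have ht := Fk_tendsto' e hg hga (r+1) hr
  have hs := Fk_sign e hg hgp (r+1) ht (r+1) le_rfl 0 le_rfl
  rw [Acoef_eq_s11 e hg hgp (r+1) ht r (by omega), ← Fk_at_zero e g r, ← abs_of_nonneg hs, abs_mul]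
  simp

lemma spline_repr {g : ℝ → ℝ} (hg : ContinuousOn g (Ici 0)) {r : ℕ} {a : ℝ} {u : ℕ → ℝ} {ε : ℝ}
    {G : ℝ → ℝ} (hr : 1 ≤ r) (h : PerfectSplineWith g r a 0 u ε G) :
    ∃ e : ℕ → ℝ, ∀ t ∈ Icc 0 a, ε * G t = Fk e g (r - 1 + 1) t := by
  obtain ⟨hε, hu0, hu1, hlt, hcd, hi⟩ := h
  obtain ⟨hc2, hd2⟩ := hi 0 le_rfl
  have hlt0 := hlt 0 le_rfl
  simp only [zero_add] at hu1 hc2 hd2 hlt0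
  rw [hu0, hu1] at hc2 hd2 hlt0
  have hεε : ε * ε = 1 := by rcases hε with h | h <;> rw [h] <;> norm_num
  have hopen : IsOpen (Ioo (0:ℝ) a) := isOpen_Ioo
  · have huD : UniqueDiffOn ℝ (Icc (0:ℝ) a) := uniqueDiffOn_Icc hlt0
    let D : ℕ → ℝ → ℝ := fun k => iteratedDerivWithin k G (Icc 0 a)
    let e : ℕ → ℝ := fun k => ε * D (r - 1 - k) 0
    -- agreement on open interval
    have hag : ∀ k, ∀ t ∈ Ioo (0:ℝ) a, D k t = iteratedDerivWithin k G (Ioo 0 a) t := by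
      intro k t ht
      show iteratedDerivWithin k G (Icc 0 a) t = _
      rw [iteratedDerivWithin, iteratedDerivWithin,
        ← iteratedFDerivWithin_inter_open (s := Icc 0 a) hopen ht,
        inter_eq_self_of_subset_right Ioo_subset_Icc_self]
    have hder : ∀ k, k < r → ∀ t ∈ Ioo (0:ℝ) a, HasDerivAt (D k) (D (k+1) t) t := by
      intro k hk t ht
      have h1 := (hc2.differentiableOn_iteratedDerivWithin (m := k) (by exact_mod_cast hk)
        hopen.uniqueDiffOn).differentiableAt (hopen.mem_nhds ht)
      have h2 : D k =ᶠ[𝓝 t] iteratedDerivWithin k G (Ioo 0 a) := by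
        filter_upwards [hopen.mem_nhds ht] with s hs using hag k s hs
      have h3 := (h1.hasDerivAt).congr_of_eventuallyEq h2
      rw [hag (k+1) t ht, iteratedDerivWithin_succ, derivWithin_of_isOpen hopen ht]
      exact h3
    have hcont : ∀ k, k < r → ContinuousOn (D k) (Icc 0 a) := by
      intro k hk
      exact hcd.continuousOn_iteratedDerivWithin (by exact_mod_cast (by omega)) huD
    have main : ∀ k, k ≤ r → (∀ t ∈ Ioo 0 a, ε * D (r - k) t = Fk e g k t) ∧
        (1 ≤ k → ∀ t ∈ Icc 0 a, ε * D (r - k) t = Fk e g k t) := by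
      intro k
      induction k with
      | zero =>
        intro _
        refine ⟨?_, by simp⟩
        intro t ht
        rw [Nat.sub_zero, hag r t ht, hd2 t ht]
        simp [Fk, ← mul_assoc, hεε]
      | succ k ih =>
        intro hk
        have ih1 := (ih (by omega)).1
        have key : ∀ t ∈ Icc 0 a, ε * D (r - (k+1)) t = Fk e g (k+1) t := by
          intro t ht
          have hI := intervalIntegral.integral_eq_sub_of_hasDerivAt_of_le
            (f := fun s => ε * D (r - (k+1)) s) (f' := Fk e g k) (a := 0) (b := t) ht.1
            (continuousOn_const.mul ((hcont _ (by omega)).mono (Icc_subset_Icc_right ht.2)))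
            (by
              intro x hx
              have hx' : x ∈ Ioo 0 a := ⟨hx.1, lt_of_lt_of_le hx.2 ht.2⟩
              rw [← ih1 x hx']
              have := hder (r - (k+1)) (by omega) x hx'
              rw [show r - (k+1) + 1 = r - k by omega] at this
              exact this.const_mul ε)
            (cont_ii (Fk_cont e hg k) le_rfl ht.1)
          simp only [Fk, hI, e]
          rw [show r - 1 - k = r - (k+1) by omega]
          ring
        exact ⟨fun t ht => key t (Ioo_subset_Icc_self ht), fun _ => key⟩
    refine ⟨e, fun t ht => ?_⟩
    rw [show r - 1 + 1 = r by omega]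
    have := (main r le_rfl).2 hr t ht
    simpa [D] using this

open Polynomial in
lemma Fk_poly (e : ℕ → ℝ) {g : ℝ → ℝ} (hg : ContinuousOn g (Ici 0)) (k : ℕ) :
    ∃ P : ℝ[X], P.natDegree < k + 1 ∧ ∀ t, 0 ≤ t → Fk e g (k+1) t = P.eval t + gk g (k+1) t := by
  refine ⟨∑ s ∈ Finset.range (k+1), Polynomial.monomial (k - s) (e s / (Nat.factorial (k-s) : ℝ)),
    ?_, ?_⟩
  · rw [Nat.lt_succ_iff]
    apply Polynomial.natDegree_sum_le_of_forall_le
    intro i _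
    exact (Polynomial.natDegree_monomial_le _).trans (by omega)
  · intro t ht
    rw [Fk_closed e hg (k+1) ht, Polynomial.eval_finsetSum]
    congr 1
    apply Finset.sum_congr rfl
    intro s _
    simp only [Polynomial.eval_monomial, Nat.add_sub_cancel]
    ring

open Polynomial in
lemma poly_Fk {g : ℝ → ℝ} (hg : ContinuousOn g (Ici 0)) (k : ℕ) (P : ℝ[X])
    (hP : P.natDegree < k + 1) :
    ∃ e : ℕ → ℝ, ∀ t, 0 ≤ t → Fk e g (k+1) t = P.eval t + gk g (k+1) t := by
  refine ⟨fun s => P.coeff (k - s) * (Nat.factorial (k-s) : ℝ), fun t ht => ?_⟩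
  rw [Fk_closed _ hg (k+1) ht, Polynomial.eval_eq_sum_range' hP]
  congr 1
  rw [← Finset.sum_range_reflect]
  apply Finset.sum_congr rfl
  intro s hs
  have hs' := Finset.mem_range.1 hs
  have : (Nat.factorial (k - (k - s)) : ℝ) ≠ 0 := by positivity
  simp only [Nat.add_sub_cancel] at *
  rw [show k - (k - s) = s by omega] at *
  field_simp

open Polynomial in
lemma poly_bound (p : ℝ[X]) {r : ℕ} (hp : p.natDegree < r) (t T B : ℝ)
    (hB : ∀ j : ℕ, 1 ≤ j → j ≤ r → |p.eval (t + j * T)| ≤ B) (hB0 : 0 ≤ B) :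
    |p.eval t| ≤ 2 ^ r * B := by
  set P := p.comp (C T * X + C t) with hPdef
  have hP : P.natDegree < r := by
    refine lt_of_le_of_lt ?_ hp
    refine Polynomial.natDegree_comp_le.trans ?_
    calc p.natDegree * (C T * X + C t).natDegree ≤ p.natDegree * 1 :=
          Nat.mul_le_mul_left _ Polynomial.natDegree_linear_le
      _ = p.natDegree := mul_one _
  have h := congrFun (Polynomial.fwdDiff_iter_eq_zero_of_degree_lt hP) 0
  rw [fwdDiff_iter_eq_sum_shift, Finset.sum_range_succ'] at h
  have hev : ∀ x, P.eval x = p.eval (t + x * T) := by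
    intro x; rw [hPdef, Polynomial.eval_comp]; congr 1; simp; ring
  simp only [hev] at h
  simp at h
  have h2 : |p.eval t| = |∑ x ∈ Finset.range r, (-1:ℝ) ^ (r - (x+1)) * (r.choose (x+1)) *
      p.eval (t + ((x:ℝ)+1) * T)| := by
    have : (-1:ℝ)^r * p.eval t = - ∑ x ∈ Finset.range r, (-1:ℝ) ^ (r - (x+1)) * (r.choose (x+1)) *
      p.eval (t + ((x:ℝ)+1) * T) := by linarith
    have h3 := congrArg abs this
    rw [abs_mul, abs_neg] at h3
    simpa using h3
  rw [h2]
  calc _ ≤ ∑ x ∈ Finset.range r, |(-1:ℝ) ^ (r - (x+1)) * (r.choose (x+1)) *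
      p.eval (t + ((x:ℝ)+1) * T)| := Finset.abs_sum_le_sum_abs _ _
    _ ≤ ∑ x ∈ Finset.range r, (r.choose (x+1) : ℝ) * B := by
      apply Finset.sum_le_sum
      intro x hx
      rw [abs_mul, abs_mul]
      simp only [abs_pow, abs_neg, abs_one, one_pow, one_mul, Nat.abs_cast]
      have := hB (x+1) (by omega) (by have := Finset.mem_range.1 hx; omega)
      push_cast at this
      gcongr
    _ ≤ 2 ^ r * B := by
      rw [← Finset.sum_mul]
      gcongr
      have h4 := Nat.sum_range_choose r
      rw [Finset.sum_range_succ'] at h4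
      have h5 : ∑ x ∈ Finset.range r, r.choose (x+1) ≤ 2 ^ r := by omega
      exact_mod_cast h5

open Polynomial in
lemma poly_alt (p : ℝ[X]) {r : ℕ} (hp : p.natDegree < r) (b : ℕ → ℝ) (σ : ℝ)
    (hb : ∀ i, 1 ≤ i → i < r + 1 → b i < b (i + 1))
    (hs : ∀ i, 1 ≤ i → i ≤ r + 1 → 0 < σ * (-1 : ℝ) ^ i * p.eval (b i)) : False := by
  have hroot : ∀ i, ∃ z, (1 ≤ i → i < r + 1 → z ∈ Ioo (b i) (b (i+1)) ∧ p.eval z = 0) := by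
    intro i
    by_cases hi : 1 ≤ i ∧ i < r + 1
    · have h1 := hs i hi.1 (by omega)
      have h2 := hs (i+1) (by omega) (by omega)
      have hlt := hb i hi.1 hi.2
      have hc : ContinuousOn (fun x => σ * (-1)^i * p.eval x) (Icc (b i) (b (i+1))) := by fun_prop
      have h0 : (0:ℝ) ∈ Ioo (σ * (-1)^i * p.eval (b (i+1))) (σ * (-1)^i * p.eval (b i)) := by
        refine ⟨?_, h1⟩
        rw [pow_succ] at h2
        linarith
      obtain ⟨z, hz, hz0⟩ := intermediate_value_Ioo' hlt.le hc h0
      refine ⟨z, fun _ _ => ⟨hz, ?_⟩⟩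
      have hne : σ * (-1)^i ≠ 0 := by
        intro h; rw [h] at h1; simp at h1
      exact (mul_eq_zero.1 hz0).resolve_left hne
    · exact ⟨0, fun h h' => absurd ⟨h, h'⟩ hi⟩
  choose z hz using hroot
  have hbm : ∀ i j, 1 ≤ i → i ≤ j → j ≤ r + 1 → b i ≤ b j := by
    intro i j hi hij
    induction j, hij using Nat.le_induction with
    | base => intro _; exact le_rfl
    | succ j hij ih => intro hj; exact (ih (by omega)).trans (hb j (by omega) (by omega)).le
  have hzm : ∀ i j, 1 ≤ i → i < j → j < r + 1 → z i < z j := by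
    intro i j hi hij hj
    exact (hz i hi (by omega)).1.2.trans_le
      ((hbm (i+1) j (by omega) hij (by omega)).trans (hz j (by omega) hj).1.1.le)
  have hinj : Set.InjOn z (Finset.Icc 1 r : Finset ℕ) := by
    intro i hi j hj hij
    simp only [Finset.coe_Icc, mem_Icc] at hi hj
    rcases lt_trichotomy i j with h | h | h
    · exact absurd hij (hzm i j hi.1 h (by omega)).ne
    · exact h
    · exact absurd hij (hzm j i hj.1 h (by omega)).ne'
  have hcard : ((Finset.Icc 1 r).image z).card = r := by
    rw [Finset.card_image_of_injOn hinj]; simp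
  have hp0 : p = 0 := by
    apply Polynomial.eq_zero_of_degree_lt_of_eval_finset_eq_zero ((Finset.Icc 1 r).image z)
    · rw [hcard]
      exact lt_of_le_of_lt Polynomial.degree_le_natDegree (by exact_mod_cast hp)
    · intro x hx
      obtain ⟨i, hi, rfl⟩ := Finset.mem_image.1 hx
      have := Finset.mem_Icc.1 hi
      exact (hz i this.1 (by omega)).2
  have := hs 1 le_rfl (by omega)
  rw [hp0] at this
  simp at this

open Polynomial in
lemma ext_repr {f g : ℝ → ℝ} (hf_c : ContinuousOn f (Ici 0)) (hf_pos : ∀ t ∈ Ici (0:ℝ), 0 < f t)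
    (hg : ContinuousOn g (Ici 0)) {n : ℕ} {M : ℝ} {G : ℝ → ℝ}
    (h : IsExtremalSpline f g (n+1) 0 M G) :
    ∃ ε : ℝ, ∃ P : ℝ[X], |ε| = 1 ∧ P.natDegree < n + 1 ∧
      (∀ t ∈ Icc 0 M, ε * G t = P.eval t + gk g (n+1) t) ∧
      (∀ t ∈ Icc 0 M, |G t| ≤ wNorm G f (Icc 0 M) * f t) := by
  obtain ⟨⟨m, hm, u, ε, hS⟩, -⟩ := h
  obtain rfl : m = 0 := by omega
  obtain ⟨e, he⟩ := spline_repr hg (by omega) hS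
  obtain ⟨P, hP, hPe⟩ := Fk_poly e hg n
  refine ⟨ε, P, ?_, hP, ?_, ?_⟩
  · rcases hS.1 with h | h <;> simp [h]
  · intro t ht
    rw [he t ht, ← hPe t ht.1]
    rfl
  · intro t ht
    have hGc : ContinuousOn G (Icc 0 M) := hS.2.2.2.2.1.continuousOn
    have hfp := hf_pos t ht.1
    have hc : ContinuousOn (fun t => |G t| / f t) (Icc 0 M) :=
      hGc.abs.div (hf_c.mono Icc_subset_Ici_self) (fun x hx => (hf_pos x hx.1).ne')
    have := le_csSup (isCompact_Icc.bddAbove_image hc) (mem_image_of_mem _ ht)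
    rw [← div_le_iff₀ hfp]
    exact this

lemma ext_le {f g : ℝ → ℝ} (hf_c : ContinuousOn f (Ici 0)) (hf_pos : ∀ t ∈ Ici (0:ℝ), 0 < f t)
    (hg : ContinuousOn g (Ici 0)) {n : ℕ} {M : ℝ} {G₁ G₂ : ℝ → ℝ}
    (h₁ : IsExtremalSpline f g (n+1) 0 M G₁) (h₂ : IsExtremalSpline f g (n+1) 0 M G₂) :
    wNorm G₂ f (Icc 0 M) ≤ wNorm G₁ f (Icc 0 M) := by
  by_contra! hlt
  obtain ⟨ε₁, P₁, hε₁, hP₁, hr₁, hb₁⟩ := ext_repr hf_c hf_pos hg h₁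
  obtain ⟨ε₂, P₂, hε₂, hP₂, hr₂, hb₂⟩ := ext_repr hf_c hf_pos hg h₂
  obtain ⟨-, b, hb0, hbM, hbi, hbv⟩ := h₂
  simp only [zero_add] at hbM hbi hbv
  have hbm : ∀ i j, 1 ≤ i → i ≤ j → j ≤ n + 1 + 1 → b i ≤ b j := by
    intro i j hi hij
    induction j, hij using Nat.le_induction with
    | base => intro _; exact le_rfl
    | succ j hij ih => intro hj; exact (ih (by omega)).trans (hbi j (by omega) (by omega)).le
  refine poly_alt (P₂ - P₁) (r := n+1) ?_ b (ε₂ * (-1)^(n+1+1)) hbi ?_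
  · exact lt_of_le_of_lt (Polynomial.natDegree_sub_le _ _) (max_lt hP₂ hP₁)
  · intro i hi hi'
    have hmem : b i ∈ Icc 0 M :=
      ⟨hb0.trans (hbm 1 i le_rfl hi hi'), hbM ▸ hbm i (n+1+1) hi hi' le_rfl⟩
    have e1 := hr₁ _ hmem
    have e2 := hr₂ _ hmem
    have e3 := hb₁ _ hmem
    have hfp := hf_pos _ hmem.1
    have e4 := hbv i hi hi'
    rw [Polynomial.eval_sub]
    have e5 : P₂.eval (b i) - P₁.eval (b i) = ε₂ * G₂ (b i) - ε₁ * G₁ (b i) := by linarith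
    have hsq : ε₂ * ε₂ = 1 := by rw [← abs_mul_abs_self, hε₂]; norm_num
    have hp : ((-1:ℝ)^(n+1+1) * (-1)^i) * (-1)^(i+(n+1)+1) = 1 := by
      rw [← pow_add, ← pow_add]
      exact Even.neg_one_pow ⟨n + 1 + 1 + i, by ring⟩
    have e6 : ε₂ * (-1)^(n+1+1) * (-1)^i * (P₂.eval (b i) - P₁.eval (b i)) =
        wNorm G₂ f (Icc 0 M) * f (b i) - (ε₂ * (-1)^(n+1+1) * (-1)^i * ε₁) * G₁ (b i) := by
      rw [e5, e4]
      linear_combination (wNorm G₂ f (Icc 0 M) * f (b i)) * hp +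
        (((-1:ℝ)^(n+1+1) * (-1)^i) * (-1)^(i+(n+1)+1)) * (wNorm G₂ f (Icc 0 M) * f (b i)) * hsq
    rw [e6]
    have e7 : (ε₂ * (-1)^(n+1+1) * (-1)^i * ε₁) * G₁ (b i) ≤ |G₁ (b i)| := by
      refine (le_abs_self _).trans ?_
      rw [abs_mul, abs_mul, abs_mul, abs_mul, hε₂, hε₁]
      simp
    have e8 := mul_lt_mul_of_pos_right hlt hfp
    linarith

open Polynomial in
lemma poly_limit {n : ℕ} (P : ℝ → ℝ[X]) (hP : ∀ M, 0 < M → (P M).natDegree < n + 1)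
    (hl : ∀ t, 0 ≤ t → ∃ l, Tendsto (fun M => (P M).eval t) atTop (𝓝 l)) :
    ∃ Q : ℝ[X], Q.natDegree < n + 1 ∧ ∀ t, Tendsto (fun M => (P M).eval t) atTop (𝓝 (Q.eval t)) := by
  choose! l hl using hl
  let v : ℕ → ℝ := fun i => (i : ℝ)
  have hv : Set.InjOn v (Finset.range (n+1) : Finset ℕ) := fun i _ j _ h => Nat.cast_injective h
  refine ⟨Lagrange.interpolate (Finset.range (n+1)) v (fun i => l i), ?_, ?_⟩
  · have := Lagrange.degree_interpolate_lt (fun i : ℕ => l (i:ℝ)) hv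
    rw [Finset.card_range] at this
    by_cases h0 : Lagrange.interpolate (Finset.range (n+1)) v (fun i => l i) = 0
    · rw [h0]; simp
    · exact (Polynomial.natDegree_lt_iff_degree_lt h0).2 this
  · intro t
    have h1 : Tendsto (fun M => ∑ i ∈ Finset.range (n+1), (P M).eval (v i) *
        (Lagrange.basis (Finset.range (n+1)) v i).eval t) atTop
        (𝓝 (∑ i ∈ Finset.range (n+1), l (v i) *
        (Lagrange.basis (Finset.range (n+1)) v i).eval t)) := by
      apply tendsto_finsetSum
      intro i _
      exact (hl (v i) (Nat.cast_nonneg i)).mul_const _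
    have h2 : (Lagrange.interpolate (Finset.range (n+1)) v (fun i => l i)).eval t =
        ∑ i ∈ Finset.range (n+1), l (v i) *
        (Lagrange.basis (Finset.range (n+1)) v i).eval t := by
      rw [Lagrange.interpolate_apply, Polynomial.eval_finsetSum]
      simp [v]
    rw [h2]
    refine h1.congr' ?_
    filter_upwards [eventually_gt_atTop 0] with M hM
    have hd : (P M).degree < (Finset.range (n+1)).card := by
      rw [Finset.card_range]
      exact lt_of_le_of_lt Polynomial.degree_le_natDegree (by exact_mod_cast hP M hM)
    conv_rhs => rw [Lagrange.eq_interpolate hv hd]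
    rw [Lagrange.interpolate_apply, Polynomial.eval_finsetSum]
    simp

/-- Equation (15): if φ_{r,0,f}(∞) < ∞ and f(∞) = 0, then |G_{r,0,f,M}(0)| → A_{r-1}
as M → ∞. -/
theorem statement11
    (f g : ℝ → ℝ)
    (hf_c : ContinuousOn f (Ici 0)) (hf_pos : ∀ t ∈ Ici (0:ℝ), 0 < f t)
    (hf_anti : AntitoneOn f (Ici 0))
    (hg_c : ContinuousOn g (Ici 0)) (hg_pos : ∀ t ∈ Ici (0:ℝ), 0 < g t)
    (hg_anti : AntitoneOn g (Ici 0))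
    (r : ℕ) (hr : 1 ≤ r)
    (hf0 : Tendsto f atTop (nhds 0))
    (φ0 : ℝ → ℝ)
    (hφ0 : ∀ a, 0 < a → ∃ G : ℝ → ℝ,
      IsExtremalSpline f g r 0 a G ∧ φ0 a = wNorm G f (Icc 0 a))
    (hfin : ∃ C, ∀ a, 0 < a → φ0 a ≤ C)
    (GM : ℝ → ℝ → ℝ) (hGM : ∀ M, 0 < M → IsExtremalSpline f g r 0 M (GM M)) :
    Tendsto (fun M => |GM M 0|) atTop (nhds (Acoef g (r - 1))) := by
  obtain ⟨n, rfl⟩ : ∃ n, r = n + 1 := ⟨r - 1, by omega⟩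
  rw [Nat.add_sub_cancel]
  obtain ⟨C, hC⟩ := hfin
  have hrep := fun M (hM : 0 < M) => ext_repr hf_c hf_pos hg_c (hGM M hM)
  choose! ε P hε hP hPe hPb using hrep
  have hbd : ∀ M, 0 < M → ∀ t ∈ Icc 0 M, |(P M).eval t + gk g (n+1) t| ≤ |C| * f t := by
    intro M hM t ht
    rw [← hPe M hM t ht, abs_mul, hε M hM, one_mul]
    refine (hPb M hM t ht).trans ?_
    have hfp := hf_pos t ht.1
    obtain ⟨G, hG, hφ⟩ := hφ0 M hM
    have h1 := ext_le hf_c hf_pos hg_c hG (hGM M hM)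
    have h2 := hC M hM
    have h3 := le_abs_self C
    exact mul_le_mul_of_nonneg_right (by linarith) hfp.le
  have hl : ∀ t, 0 ≤ t → ∃ l, Tendsto (fun M => (P M).eval t) atTop (𝓝 l) := by
    intro t ht
    apply cauchySeq_tendsto_of_complete
    rw [Metric.cauchySeq_iff]
    intro δ hδ
    have hT : Tendsto (fun T => 2 ^ (n+1) * (2 * (|C| * f T))) atTop (𝓝 0) := by
      simpa using ((hf0.const_mul |C|).const_mul 2).const_mul ((2:ℝ) ^ (n+1))
    obtain ⟨T, hTδ, hT0⟩ := ((hT.eventually (gt_mem_nhds hδ)).and (eventually_gt_atTop 0)).exists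
    refine ⟨t + (n+1) * T, fun M hM M' hM' => ?_⟩
    have hpos : 0 < t + (n+1) * T := by positivity
    have hM0 : 0 < M := hpos.trans_le hM
    have hM0' : 0 < M' := hpos.trans_le hM'
    have hfT := hf_pos T hT0.le
    have key := poly_bound (P M - P M') (r := n+1)
      (lt_of_le_of_lt (Polynomial.natDegree_sub_le _ _) (max_lt (hP M hM0) (hP M' hM0')))
      t T (2 * (|C| * f T)) ?_ (by positivity)
    · rw [Real.dist_eq]
      rw [Polynomial.eval_sub] at key
      exact key.trans_lt hTδ
    · intro j hj1 hj2
      have hj1' : (1:ℝ) ≤ j := by exact_mod_cast hj1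
      have hj2' : (j:ℝ) ≤ n + 1 := by exact_mod_cast hj2
      have a1 : T ≤ t + j * T := by nlinarith
      have a2 : t + j * T ≤ t + (n+1) * T := by nlinarith
      have b1 := hbd M hM0 (t + j * T) ⟨hT0.le.trans a1, a2.trans hM⟩
      have b2 := hbd M' hM0' (t + j * T) ⟨hT0.le.trans a1, a2.trans hM'⟩
      have b3 : |C| * f (t + j * T) ≤ |C| * f T :=
        mul_le_mul_of_nonneg_left (hf_anti hT0.le (hT0.le.trans a1) a1) (abs_nonneg _)
      rw [Polynomial.eval_sub]
      rw [abs_le] at b1 b2 ⊢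
      constructor <;> linarith
  obtain ⟨Q, hQ, hQl⟩ := poly_limit P hP hl
  obtain ⟨e, he⟩ := poly_Fk hg_c n Q hQ
  have hQb : ∀ t, 0 ≤ t → |Fk e g (n+1) t| ≤ |C| * f t := by
    intro t ht
    rw [he t ht]
    refine le_of_tendsto ((hQl t).add_const (gk g (n+1) t)).abs ?_
    filter_upwards [eventually_ge_atTop t, eventually_gt_atTop 0] with M hM hM0
    exact hbd M hM0 t ⟨ht, hM⟩
  have hF0 : Tendsto (Fk e g (n+1)) atTop (𝓝 0) := by
    rw [tendsto_zero_iff_abs_tendsto_zero]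
    have hC0 : Tendsto (fun t => |C| * f t) atTop (𝓝 0) := by simpa using hf0.const_mul |C|
    refine tendsto_of_tendsto_of_tendsto_of_le_of_le' tendsto_const_nhds hC0 ?_ ?_
    · exact Eventually.of_forall fun t => abs_nonneg _
    · filter_upwards [eventually_ge_atTop 0] with t ht using hQb t ht
  rw [← A_abs e hg_c hg_anti hg_pos n hF0, he 0 le_rfl]
  refine ((hQl 0).add_const (gk g (n+1) 0)).abs.congr' ?_
  filter_upwards [eventually_gt_atTop 0] with M hM
  rw [← hPe M hM 0 ⟨le_rfl, hM.le⟩, abs_mul, hε M hM, one_mul]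
end

section
/- Let f and g be continuous, positive, non-increasing functions on [0,∞), let r ∈ ℕ, and assume φ_{r,0,f}(∞) = ∞. Fix δ > 0 and k ∈ {1, …, r−1}. For each n ∈ ℤ₊ let δ_{r,n} > 0 be the (unique) number with φ_{r,n,f}(δ_{r,n}) = δ. Then the limit lim_{n→∞} |G_{r,n,f,δ_{r,n}}^{(k)}(0)| exists and ω(D^k, δ) = lim_{n→∞} |G_{r,n,f,δ_{r,n}}^{(k)}(0)|. -/
open Set Filter MeasureTheory
open scoped Topology

def ZS (F : ℝ → ℝ) (T : Set ℝ) (N : ℕ) : Prop :=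
  ∃ z : ℕ → ℝ, (∀ i < N, z i ∈ T ∧ F (z i) = 0) ∧ ∀ i, i + 1 < N → z i < z (i + 1)

lemma ZS_rolle {F F' : ℝ → ℝ} {S T : Set ℝ} [hT : OrdConnected T] (hTS : T ⊆ S)
    (hd : ∀ t ∈ S, HasDerivWithinAt F (F' t) S t) {N : ℕ} (h : ZS F T (N + 1)) : ZS F' T N := by
  obtain ⟨z, hz, hm⟩ := h
  have key : ∀ i, ∃ w, i < N → (z i < w ∧ w < z (i+1) ∧ F' w = 0) := by
    intro i
    by_cases hi : i < N
    · have hsub : Icc (z i) (z (i+1)) ⊆ T :=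
        hT.out (hz i (by omega)).1 (hz (i+1) (by omega)).1
      obtain ⟨w, hw, hw0⟩ := exists_hasDerivAt_eq_zero (f := F) (f' := F') (hm i (by omega))
        (fun t ht => ((hd t (hTS (hsub ht))).continuousWithinAt.mono
          (hsub.trans hTS)))
        (by rw [(hz i (by omega)).2, (hz (i+1) (by omega)).2])
        (fun t ht => (hd t (hTS (hsub (Ioo_subset_Icc_self ht)))).hasDerivAt
          (mem_of_superset (Icc_mem_nhds ht.1 ht.2) (hsub.trans hTS)))
      exact ⟨w, fun _ => ⟨hw.1, hw.2, hw0⟩⟩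
    · exact ⟨0, fun h => absurd h hi⟩
  choose w hw using key
  refine ⟨w, fun i hi => ⟨?_, (hw i hi).2.2⟩, fun i hi => ?_⟩
  · exact hT.out (hz i (by omega)).1 (hz (i+1) (by omega)).1
      ⟨(hw i hi).1.le, (hw i hi).2.1.le⟩
  · exact (hw i (by omega)).2.1.trans (hw (i+1) hi).1

lemma ZS_iter {y : ℕ → ℝ → ℝ} {S T : Set ℝ} [hT : OrdConnected T] (hTS : T ⊆ S) {p : ℕ}
    (hd : ∀ j < p, ∀ t ∈ S, HasDerivWithinAt (y j) (y (j+1) t) S t) (N j : ℕ) :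
    ∀ l, j + l ≤ p → ZS (y j) T (N + l) → ZS (y (j + l)) T N := by
  intro l
  induction l generalizing N with
  | zero => intro _ h; exact h
  | succ l ih =>
    intro hl h
    have := ih (N + 1) (by omega) (by convert h using 1; omega)
    exact ZS_rolle hTS (hd (j + l) (by omega)) this

lemma ZS_osc {F : ℝ → ℝ} {α β : ℝ} (hF : ContinuousOn F (Icc α β)) {N : ℕ} {b : ℕ → ℝ}
    (hb : ∀ i < N + 1, b i ∈ Icc α β) (hm : ∀ i < N, b i < b (i + 1))
    (hs : ∀ i < N, F (b i) * F (b (i + 1)) < 0) : ZS F (Ioo α β) N := by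
  have key : ∀ i, ∃ w, i < N → (b i < w ∧ w < b (i+1) ∧ F w = 0) := by
    intro i
    by_cases hi : i < N
    · have hsub : Icc (b i) (b (i+1)) ⊆ Icc α β :=
        Icc_subset_Icc (hb i (by omega)).1 (hb (i+1) (by omega)).2
      have hle := (hm i hi).le
      rcases mul_neg_iff.1 (hs i hi) with h | h
      · obtain ⟨w, hw, h0⟩ := intermediate_value_Ioo' hle (hF.mono hsub) ⟨h.2, h.1⟩
        exact ⟨w, fun _ => ⟨hw.1, hw.2, h0⟩⟩
      · obtain ⟨w, hw, h0⟩ := intermediate_value_Ioo hle (hF.mono hsub) ⟨h.1, h.2⟩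
        exact ⟨w, fun _ => ⟨hw.1, hw.2, h0⟩⟩
    · exact ⟨0, fun h => absurd h hi⟩
  choose w hw using key
  refine ⟨w, fun i hi => ⟨⟨?_, ?_⟩, (hw i hi).2.2⟩, fun i hi => ?_⟩
  · exact (hb i (by omega)).1.trans_lt (hw i hi).1
  · exact (hw i hi).2.1.trans_le (hb (i+1) (by omega)).2
  · exact (hw i (by omega)).2.1.trans (hw (i+1) hi).1

lemma ZS_cons {F : ℝ → ℝ} {a : ℝ} (ha : 0 < a) {N : ℕ} (h : ZS F (Ioo 0 a) N) (h0 : F 0 = 0) :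
    ZS F (Icc 0 a) (N + 1) := by
  obtain ⟨z, hz, hm⟩ := h
  refine ⟨fun i => Nat.casesOn i 0 z, ?_, ?_⟩
  · rintro (_ | i) hi
    · exact ⟨⟨le_rfl, ha.le⟩, h0⟩
    · exact ⟨Ioo_subset_Icc_self (hz i (by omega)).1, (hz i (by omega)).2⟩
  · rintro (_ | i) hi
    · exact (hz 0 (by omega)).1.1
    · exact hm i (by omega)

structure Spl (f g : ℝ → ℝ) (δ : ℝ) (p n : ℕ) (a : ℝ) (G : ℕ → ℝ → ℝ) : Prop where
  der : ∀ j < p, ∀ t ∈ Icc 0 a, HasDerivWithinAt (G j) (G (j+1) t) (Icc 0 a) t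
  bd : ∀ t ∈ Icc 0 a, |G 0 t| ≤ δ * f t
  inc : ∀ s t, 0 ≤ s → s ≤ t → t ≤ a → |G p t - G p s| ≤ ∫ v in s..t, g v
  pieces : ∃ m ≤ n, ∃ u : ℕ → ℝ, u 0 = 0 ∧ u (m+1) = a ∧ (∀ i ≤ m, u i < u (i+1)) ∧
    ∀ i ≤ m, ∃ e : ℝ, |e| = 1 ∧ ∀ s t, u i ≤ s → s ≤ t → t ≤ u (i+1) →
      G p t - G p s = e * ∫ v in s..t, g v
  osc : ∃ b : ℕ → ℝ, ∃ σ : ℝ, |σ| = 1 ∧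
    (∀ i < n + p + 2, b i ∈ Icc 0 a ∧ G 0 (b i) = σ * (-1)^i * (δ * f (b i))) ∧
    ∀ i, i + 1 < n + p + 2 → b i < b (i+1)

lemma find_piece {u : ℕ → ℝ} {t : ℝ} (h0 : u 0 ≤ t) :
    ∀ m, t ≤ u (m+1) → ∃ i ≤ m, u i ≤ t ∧ t ≤ u (i+1) := by
  intro m
  induction m with
  | zero => intro h; exact ⟨0, le_rfl, h0, h⟩
  | succ m ih =>
    intro h
    by_cases hh : t ≤ u (m+1)
    · obtain ⟨i, hi, h1⟩ := ih hh
      exact ⟨i, by omega, h1⟩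
    · exact ⟨m+1, le_rfl, (not_le.1 hh).le, h⟩

lemma u_mono {u : ℕ → ℝ} {m : ℕ} (hu : ∀ i ≤ m, u i < u (i+1)) :
    ∀ i ≤ m + 1, u 0 ≤ u i ∧ u i ≤ u (m+1) := by
  have h1 : ∀ i, i ≤ m + 1 → u 0 ≤ u i := by
    intro i
    induction i with
    | zero => intro _; exact le_rfl
    | succ i ih => intro h; exact (ih (by omega)).trans (hu i (by omega)).le
  have h2 : ∀ c i, i + c = m + 1 → u i ≤ u (m+1) := by
    intro c
    induction c with
    | zero => intro i h; simp at h; rw [h]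
    | succ c ih => intro i h; exact (hu i (by omega)).le.trans (ih (i+1) (by omega))
  exact fun i hi => ⟨h1 i hi, h2 (m + 1 - i) i (by omega)⟩

lemma g_int {g : ℝ → ℝ} (hg_c : ContinuousOn g (Ici 0)) {s t : ℝ} (hs : 0 ≤ s) (hst : s ≤ t) :
    IntervalIntegrable g volume s t :=
  (hg_c.mono (by rw [uIcc_of_le hst]; exact fun x hx => hs.trans hx.1)).intervalIntegrable

lemma g_int_pos {g : ℝ → ℝ} (hg_c : ContinuousOn g (Ici 0)) (hg_pos : ∀ t ∈ Ici (0:ℝ), 0 < g t)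
    {s t : ℝ} (hs : 0 ≤ s) (hst : s < t) : 0 < ∫ v in s..t, g v :=
  intervalIntegral.intervalIntegral_pos_of_pos_on (g_int hg_c hs hst.le)
    (fun x hx => hg_pos x (hs.trans hx.1.le)) hst

lemma g_int_le {g : ℝ → ℝ} (hg_c : ContinuousOn g (Ici 0)) (hg_anti : AntitoneOn g (Ici 0))
    {s t : ℝ} (hs : 0 ≤ s) (hst : s ≤ t) : ∫ v in s..t, g v ≤ g 0 * (t - s) := by
  have := intervalIntegral.integral_mono_on hst (g_int hg_c hs hst)
    (intervalIntegrable_const (c := g 0) (μ := volume))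
    (fun x hx => hg_anti (mem_Ici.2 le_rfl) (hs.trans hx.1) (hs.trans hx.1))
  simpa [mul_comm] using this

lemma g_int_shift {g : ℝ → ℝ} (hg_c : ContinuousOn g (Ici 0)) (hg_anti : AntitoneOn g (Ici 0))
    {s t τ : ℝ} (hs : 0 ≤ s) (hst : s ≤ t) (hτ : 0 ≤ τ) :
    ∫ v in (s+τ)..(t+τ), g v ≤ ∫ v in s..t, g v := by
  rw [← intervalIntegral.integral_comp_add_right (fun v => g v) τ]
  refine intervalIntegral.integral_mono_on hst ?_ (g_int hg_c hs hst) ?_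
  · exact (hg_c.comp (f := fun x => x + τ) (s := Icc s t) (by fun_prop)
      (fun x hx => mem_Ici.2 (by linarith [hx.1]))).intervalIntegrable_of_Icc hst
  · intro x hx
    exact hg_anti (mem_Ici.2 (by linarith [hx.1])) (mem_Ici.2 (by linarith [hx.1])) (by linarith)

/-- Comparison at zero. -/
lemma compare {f g : ℝ → ℝ} (hf_pos : ∀ t ∈ Ici (0:ℝ), 0 < f t)
    (hg_c : ContinuousOn g (Ici 0)) (hg_pos : ∀ t ∈ Ici (0:ℝ), 0 < g t)
    {δ : ℝ} (hδ : 0 < δ) {p n : ℕ} (hp : 0 < p) {a : ℝ} (ha : 0 < a) {G : ℕ → ℝ → ℝ}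
    (hG : Spl f g δ p n a G) {y : ℕ → ℝ → ℝ}
    (hy : ∀ j < p, ∀ t ∈ Icc 0 a, HasDerivWithinAt (y j) (y (j+1) t) (Icc 0 a) t)
    (hyb : ∀ t ∈ Icc 0 a, |y 0 t| ≤ δ * f t)
    (hyi : ∀ s t, 0 ≤ s → s ≤ t → t ≤ a → |y p t - y p s| ≤ ∫ v in s..t, g v)
    {k : ℕ} (hk : k ≤ p) : |y k 0| ≤ |G k 0| := by
  by_contra hcon
  push Not at hcon
  have hy0 : y k 0 ≠ 0 := by
    intro h; rw [h, abs_zero] at hcon; exact absurd hcon (not_lt.2 (abs_nonneg _))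
  set l : ℝ := G k 0 / y k 0 with hl
  have hl1 : |l| < 1 := by
    rw [hl, abs_div, div_lt_one (abs_pos.2 hy0)]; exact hcon
  let h : ℕ → ℝ → ℝ := fun j t => G j t - l * y j t
  have hd : ∀ j < p, ∀ t ∈ Icc 0 a, HasDerivWithinAt (h j) (h (j+1) t) (Icc 0 a) t :=
    fun j hj t ht => (hG.der j hj t ht).sub ((hy j hj t ht).const_mul l)
  have hk0 : h k 0 = 0 := by
    simp only [h, hl]; field_simp; ring
  obtain ⟨b, σ, hσ, hb, hbm⟩ := hG.osc
  have hz0 : ZS (h 0) (Ioo 0 a) (n + p + 1) := by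
    refine ZS_osc (b := b) (fun t ht => (hd 0 hp t ht).continuousWithinAt)
      (fun i hi => (hb i (by omega)).1) (fun i hi => hbm i (by omega)) ?_
    have hsg : ∀ i < n + p + 2, 0 < σ * (-1)^i * h 0 (b i) := by
      intro i hi
      have h1 := (hb i hi).2
      have h2 := hyb _ (hb i hi).1
      have h3 : 0 < δ * f (b i) := mul_pos hδ (hf_pos _ (hb i hi).1.1)
      have hs : |σ * (-1)^i| = 1 := by rw [abs_mul, hσ, abs_pow]; simp
      have hs2 : (σ * (-1)^i) * (σ * (-1)^i) = 1 := by
        rw [← abs_mul_abs_self, hs]; norm_num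
      have h4 : |(σ * (-1)^i) * (l * y 0 (b i))| < δ * f (b i) := by
        rw [abs_mul, hs, one_mul, abs_mul]
        calc |l| * |y 0 (b i)| ≤ |l| * (δ * f (b i)) := by gcongr
          _ < 1 * (δ * f (b i)) := by gcongr
          _ = _ := one_mul _
      have h5 := (abs_lt.1 h4).2
      have : σ * (-1)^i * h 0 (b i) = (σ * (-1)^i) * (σ * (-1)^i) * (δ * f (b i))
          - (σ * (-1)^i) * (l * y 0 (b i)) := by simp only [h, h1]; ring
      rw [this, hs2]; linarith
    intro i hi
    have h1 := hsg i (by omega)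
    have h2 := hsg (i+1) (by omega)
    have h3 := mul_pos h1 h2
    have hσ2 : σ * σ = 1 := by rw [← abs_mul_abs_self, hσ]; norm_num
    have hp2 : ((-1:ℝ)^i) * (-1)^i = 1 := by rw [← mul_pow]; norm_num
    have : σ * (-1)^i * h 0 (b i) * (σ * (-1)^(i+1) * h 0 (b (i+1)))
      = - ((σ * σ) * ((-1)^i * (-1)^i) * (h 0 (b i) * h 0 (b (i+1)))) := by ring
    rw [this, hσ2, hp2] at h3
    linarith
  have hzk : ZS (h (0 + k)) (Ioo 0 a) (n + p + 1 - k) :=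
    ZS_iter Ioo_subset_Icc_self hd (n + p + 1 - k) 0 k (by omega)
      (by convert hz0 using 1; omega)
  rw [zero_add] at hzk
  have hzk' := ZS_cons ha hzk hk0
  have hzp : ZS (h (k + (p - k))) (Icc 0 a) (n + 2) :=
    ZS_iter subset_rfl hd (n + 2) k (p - k) (by omega) (by convert hzk' using 1; omega)
  rw [show k + (p - k) = p by omega] at hzp
  obtain ⟨z, hz, hzm⟩ := hzp
  obtain ⟨m, hmn, u, hu0, hua, hum, hpc⟩ := hG.pieces
  have hpi : ∀ i : ℕ, ∃ q ≤ m, i < n + 2 → u q ≤ z i ∧ z i ≤ u (q+1) := by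
    intro i
    by_cases hi : i < n + 2
    · obtain ⟨q, hq, h1⟩ := find_piece (u := u) (t := z i) (by rw [hu0]; exact (hz i hi).1.1) m
        (by rw [hua]; exact (hz i hi).1.2)
      exact ⟨q, hq, fun _ => h1⟩
    · exact ⟨0, by omega, fun h => absurd h hi⟩
  choose q hqm hq using hpi
  obtain ⟨i, hi, j, hj, hij, hqq⟩ := Finset.exists_ne_map_eq_of_card_lt_of_maps_to
    (s := Finset.range (n+2)) (t := Finset.range (m+1)) (f := q)
    (by simp; omega) (fun i _ => by simp; have := hqm i; omega)
  have hzlt : ∀ c i, i + c + 1 < n + 2 → z i < z (i + c + 1) := by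
    intro c
    induction c with
    | zero => intro i hi; exact hzm i hi
    | succ c ih => intro i hi; exact (ih i (by omega)).trans (hzm _ hi)
  have main : ∀ i j, i < j → j < n + 2 → q i = q j → False := by
    intro i j hij hj hqq
    have hlt : z i < z j := by
      have := hzlt (j - i - 1) i (by omega)
      rwa [show i + (j - i - 1) + 1 = j by omega] at this
    obtain ⟨e, he, hpe⟩ := hpc (q i) (hqm i)
    have hi := hq i (by omega)
    have hj2 := hq j hj
    rw [← hqq] at hj2
    have hinc := hpe (z i) (z j) hi.1 hlt.le hj2.2
    have hy2 := hyi (z i) (z j) (hz i (by omega)).1.1 hlt.le (hz j hj).1.2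
    have hpos := g_int_pos hg_c hg_pos (hz i (by omega)).1.1 hlt
    have e1 := (hz i (by omega)).2
    have e2 := (hz j hj).2
    simp only [h] at e1 e2
    have : G p (z j) - G p (z i) = l * (y p (z j) - y p (z i)) := by linarith
    rw [hinc] at this
    have := congrArg abs this
    rw [abs_mul, abs_mul, he, one_mul, abs_of_pos hpos] at this
    have h6 : |l| * |y p (z j) - y p (z i)| ≤ |l| * ∫ v in (z i)..(z j), g v := by gcongr
    nlinarith
  simp at hi hj
  rcases lt_or_gt_of_ne hij with h1 | h1
  · exact main i j h1 hj hqq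
  · exact main j i h1 hi hqq.symm

/-- Comparison with shift. -/
lemma compare_shift {f g : ℝ → ℝ} (hf_pos : ∀ t ∈ Ici (0:ℝ), 0 < f t)
    (hf_anti : AntitoneOn f (Ici 0))
    (hg_c : ContinuousOn g (Ici 0)) (hg_pos : ∀ t ∈ Ici (0:ℝ), 0 < g t)
    (hg_anti : AntitoneOn g (Ici 0))
    {δ : ℝ} (hδ : 0 < δ) {p n : ℕ} (hp : 0 < p) {a : ℝ} (ha : 0 < a) {G : ℕ → ℝ → ℝ}
    (hG : Spl f g δ p n a G) {y : ℕ → ℝ → ℝ} {S : Set ℝ} {τ : ℝ} (hτ : 0 ≤ τ)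
    (hS : Icc τ (a + τ) ⊆ S)
    (hy : ∀ j < p, ∀ t ∈ S, HasDerivWithinAt (y j) (y (j+1) t) S t)
    (hyb : ∀ t ∈ S, |y 0 t| ≤ δ * f t)
    (hyi : ∀ s t, 0 ≤ s → s ≤ t → t ∈ S → |y p t - y p s| ≤ ∫ v in s..t, g v)
    {k : ℕ} (hk : k ≤ p) : |y k τ| ≤ |G k 0| := by
  have hm : ∀ t ∈ Icc 0 a, t + τ ∈ S := fun t ht => hS ⟨by linarith [ht.1], by linarith [ht.2]⟩
  have := compare hf_pos hg_c hg_pos hδ hp ha hG (y := fun j t => y j (t + τ)) ?_ ?_ ?_ hk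
  · simpa using this
  · intro j hj t ht
    have h1 : HasDerivWithinAt (fun t : ℝ => t + τ) 1 (Icc 0 a) t :=
      ((hasDerivAt_id t).add_const τ).hasDerivWithinAt
    have := (hy j hj (t + τ) (hm t ht)).comp t h1 (fun t ht => hm t ht)
    simpa [Function.comp_def] using this
  · intro t ht
    refine (hyb _ (hm t ht)).trans ?_
    gcongr
    exact hf_anti (mem_Ici.2 ht.1) (mem_Ici.2 (by linarith [ht.1])) (by linarith)
  · intro s t hs hst hta
    exact (hyi (s+τ) (t+τ) (by linarith) (by linarith) (hm t ⟨by linarith, hta⟩)).trans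
      (g_int_shift hg_c hg_anti hs hst hτ)

lemma d_large {f g : ℝ → ℝ} (hf_pos : ∀ t ∈ Ici (0:ℝ), 0 < f t)
    (hf_anti : AntitoneOn f (Ici 0))
    (hg_c : ContinuousOn g (Ici 0)) (hg_pos : ∀ t ∈ Ici (0:ℝ), 0 < g t)
    (hg_anti : AntitoneOn g (Ici 0))
    {δ : ℝ} (hδ : 0 < δ) {p : ℕ} (hp : 0 < p) {A : ℝ} (hA : 0 < A) :
    ∃ N, ∀ n ≥ N, ∀ a G, Spl f g δ p n a G → A ≤ a := by
  have hg0 : 0 < g 0 := hg_pos 0 (mem_Ici.2 le_rfl)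
  have hfA : 0 < δ * f A := mul_pos hδ (hf_pos A hA.le)
  obtain ⟨h, hh0, hh⟩ : ∃ h : ℝ, 0 < h ∧ g 0 * h^(p+1) < δ * f A := by
    refine ⟨min 1 (δ * f A / (2 * g 0)), by positivity, ?_⟩
    set h := min 1 (δ * f A / (2 * g 0))
    have h0 : 0 < h := by positivity
    have h1 : h ≤ 1 := min_le_left _ _
    have h2 : h ≤ δ * f A / (2 * g 0) := min_le_right _ _
    have h3 : h^(p+1) ≤ h := by
      simpa using pow_le_pow_of_le_one h0.le h1 (show 1 ≤ p + 1 by omega)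
    calc g 0 * h^(p+1) ≤ g 0 * (δ * f A / (2 * g 0)) := by gcongr; exact h3.trans h2
      _ = δ * f A / 2 := by field_simp
      _ < δ * f A := by linarith
  obtain ⟨q, hq⟩ := exists_nat_gt (A / h)
  rw [div_lt_iff₀ hh0] at hq
  refine ⟨q * (p+1), fun n hn a G hG => ?_⟩
  by_contra hlt
  push Not at hlt
  obtain ⟨b, σ, hσ, hb, hbm⟩ := hG.osc
  have hidx : ∀ i, i ≤ q → i * (p+1) ≤ n := fun i hi => (Nat.mul_le_mul_right _ hi).trans hn
  have hex : ∃ i < q, b ((i+1)*(p+1)) - b (i*(p+1)) ≤ h := by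
    by_contra hcon
    push Not at hcon
    have : ∀ i ≤ q, (i:ℝ) * h ≤ b (i*(p+1)) - b 0 := by
      intro i
      induction i with
      | zero => intro _; simp
      | succ i ih =>
        intro hi
        have h1 := ih (by omega)
        have h2 := hcon i (by omega)
        push_cast; linarith
    have h1 := this q le_rfl
    have h2 := (hb (q*(p+1)) (by have := hidx q le_rfl; omega)).1.2
    have h3 := (hb 0 (by omega)).1.1
    linarith
  obtain ⟨i, hi, hbl⟩ := hex
  have hin := hidx (i+1) hi
  set s := i * (p+1) with hs
  rw [show (i+1)*(p+1) = s + (p+1) by rw [hs]; ring] at hbl hin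
  have hbj : ∀ c, c ≤ p + 1 → b s ≤ b (s + c) := by
    intro c
    induction c with
    | zero => intro _; exact le_rfl
    | succ c ih => intro hc; exact (ih (by omega)).trans (hbm (s+c) (by omega)).le
  have hbj2 : ∀ c e, e + c = p + 1 → b (s + e) ≤ b (s + (p+1)) := by
    intro c
    induction c with
    | zero => intro e he; simp at he; rw [he]
    | succ c ih =>
      intro e he
      exact (hbm (s+e) (by omega)).le.trans (ih (e+1) (by omega))
  have hsub : Icc (b s) (b (s + (p+1))) ⊆ Icc 0 a :=
    Icc_subset_Icc (hb s (by omega)).1.1 (hb _ (by omega)).1.2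
  have hz0 : ZS (G 0) (Ioo (b s) (b (s + (p+1)))) (p+1) := by
    refine ZS_osc (b := fun i => b (s + i))
      (fun t ht => (hG.der 0 hp t (hsub ht)).continuousWithinAt.mono hsub)
      (fun c hc => ⟨hbj c (by omega), hbj2 (p+1-c) c (by omega)⟩)
      (fun c hc => hbm (s+c) (by omega)) ?_
    intro c hc
    have h1 := (hb (s+c) (by omega))
    have h2 := (hb (s+(c+1)) (by omega))
    simp only [h1.2, h2.2]
    have hσ2 : σ * σ = 1 := by rw [← abs_mul_abs_self, hσ]; norm_num
    have hp2 : ((-1:ℝ)^(s+c)) * (-1)^(s+c) = 1 := by rw [← mul_pow]; norm_num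
    have e1 : σ * (-1) ^ (s + c) * (δ * f (b (s + c))) *
        (σ * (-1) ^ (s + (c + 1)) * (δ * f (b (s + (c + 1)))))
      = - ((σ * σ) * ((-1)^(s+c) * (-1)^(s+c)) *
        ((δ * f (b (s + c))) * (δ * f (b (s + (c + 1)))))) := by
      rw [← add_assoc s c 1, pow_succ]; ring
    rw [e1, hσ2, hp2]
    have := mul_pos (mul_pos hδ (hf_pos _ h1.1.1)) (mul_pos hδ (hf_pos _ h2.1.1))
    linarith
  have hξ : ∀ j ≤ p, ∃ ξ ∈ Icc (b s) (b (s + (p+1))), G j ξ = 0 := by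
    intro j hj
    have := ZS_iter (Ioo_subset_Icc_self.trans hsub) hG.der (p+1-j) 0 j (by omega)
      (by convert hz0 using 1; omega)
    rw [zero_add] at this
    obtain ⟨z, hz, _⟩ := this
    exact ⟨z 0, Ioo_subset_Icc_self (hz 0 (by omega)).1, (hz 0 (by omega)).2⟩
  have hdist : ∀ x ∈ Icc (b s) (b (s + (p+1))), ∀ y ∈ Icc (b s) (b (s + (p+1))),
      |x - y| ≤ h := fun x hx y hy =>
    abs_le.2 ⟨by linarith [hx.1, hy.2], by linarith [hx.2, hy.1]⟩
  have hdesc : ∀ c ≤ p, ∀ t ∈ Icc (b s) (b (s + (p+1))), |G (p-c) t| ≤ g 0 * h^(c+1) := by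
    intro c
    induction c with
    | zero =>
      intro _ t ht
      obtain ⟨ξ, hξm, hξ0⟩ := hξ p le_rfl
      have hd := hdist t ht ξ hξm
      have hkey : |G p t - G p ξ| ≤ g 0 * |t - ξ| := by
        rcases le_total ξ t with hle | hle
        · rw [abs_of_nonneg (sub_nonneg.2 hle)]
          exact (hG.inc ξ t (hsub hξm).1 hle (hsub ht).2).trans
            (g_int_le hg_c hg_anti (hsub hξm).1 hle)
        · rw [abs_sub_comm, abs_sub_comm t, abs_of_nonneg (sub_nonneg.2 hle)]
          exact (hG.inc t ξ (hsub ht).1 hle (hsub hξm).2).trans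
            (g_int_le hg_c hg_anti (hsub ht).1 hle)
      rw [hξ0, sub_zero] at hkey
      simp only [Nat.sub_zero, zero_add, pow_one]
      exact hkey.trans (by gcongr)
    | succ c ih =>
      intro hc t ht
      obtain ⟨ξ, hξm, hξ0⟩ := hξ (p-(c+1)) (by omega)
      have := (convex_Icc (b s) (b (s + (p+1)))).norm_image_sub_le_of_norm_hasDerivWithin_le
        (f := G (p-(c+1))) (f' := G (p-(c+1)+1)) (C := g 0 * h^(c+1))
        (fun x hx => (hG.der _ (by omega) x (hsub hx)).mono hsub)
        (fun x hx => by
          rw [show p-(c+1)+1 = p - c by omega]; exact ih (by omega) x hx) hξm ht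
      rw [hξ0, sub_zero, Real.norm_eq_abs, Real.norm_eq_abs] at this
      have hd := hdist t ht ξ hξm
      calc _ ≤ _ := this
        _ ≤ g 0 * h^(c+1) * h := by gcongr
        _ = _ := by ring
  have hbs := hb s (by omega)
  have h1 := hdesc p le_rfl (b s) ⟨le_rfl, hbj (p+1) le_rfl⟩
  rw [Nat.sub_self, hbs.2, abs_mul, abs_mul, hσ, abs_pow, abs_neg, abs_one, one_pow, one_mul,
    one_mul, abs_of_pos (mul_pos hδ (hf_pos _ hbs.1.1))] at h1
  have h2 : f A ≤ f (b s) := hf_anti (mem_Ici.2 hbs.1.1) (mem_Ici.2 hA.le)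
    (hbs.1.2.trans hlt.le)
  have h3 : δ * f A ≤ δ * f (b s) := by gcongr
  linarith

lemma limit_fn {f g : ℝ → ℝ} (hf_pos : ∀ t ∈ Ici (0:ℝ), 0 < f t)
    (hf_anti : AntitoneOn f (Ici 0))
    (hg_c : ContinuousOn g (Ici 0)) (hg_pos : ∀ t ∈ Ici (0:ℝ), 0 < g t)
    (hg_anti : AntitoneOn g (Ici 0))
    {δ : ℝ} (hδ : 0 < δ) {p : ℕ} (hp : 0 < p) {d : ℕ → ℝ} (hd : ∀ n, 0 < d n)
    {F : ℕ → ℕ → ℝ → ℝ} (hF : ∀ n, Spl f g δ p n (d n) (F n))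
    (U : Ultrafilter ℕ) (hU : (U : Filter ℕ) ≤ atTop) :
    ∃ y : ℕ → ℝ → ℝ,
      (∀ j ≤ p, ∀ t, 0 ≤ t → Tendsto (fun n => F n j t) U (𝓝 (y j t))) ∧
      (∀ j < p, ∀ t ∈ Ici (0:ℝ), HasDerivWithinAt (y j) (y (j+1) t) (Ici 0) t) ∧
      (∀ t ∈ Ici (0:ℝ), |y 0 t| ≤ δ * f t) ∧
      (∀ s t, 0 ≤ s → s ≤ t → |y p t - y p s| ≤ ∫ v in s..t, g v) := by
  have hg0 : 0 < g 0 := hg_pos 0 (mem_Ici.2 le_rfl)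
  have hlarge : ∀ A, ∀ᶠ n in (U : Filter ℕ), A ≤ d n := by
    intro A
    obtain ⟨N, hN⟩ := d_large hf_pos hf_anti hg_c hg_pos hg_anti hδ hp
      (A := max A 1) (by positivity)
    exact ((eventually_ge_atTop N).filter_mono hU).mono
      (fun n hn => (le_max_left _ _).trans (hN n hn _ _ (hF n)))
  have hbd : ∀ j ≤ p, ∀ n t, 0 ≤ t → t ≤ d n - d 0 → |F n j t| ≤ |F 0 j 0| := by
    intro j hj n t ht htd
    exact compare_shift hf_pos hf_anti hg_c hg_pos hg_anti hδ hp (hd 0) (hF 0)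
      (S := Icc 0 (d n)) ht (Icc_subset_Icc ht (by linarith)) (hF n).der (hF n).bd
      (fun s t h1 h2 h3 => (hF n).inc s t h1 h2 h3.2) hj
  have hlip : ∀ j ≤ p, ∀ n s t, s ∈ Icc 0 (d n - d 0) → t ∈ Icc 0 (d n - d 0) →
      |F n j t - F n j s| ≤ (|F 0 (j+1) 0| + g 0) * |t - s| := by
    intro j hj n s t hs ht
    have hsub : Icc 0 (d n - d 0) ⊆ Icc 0 (d n) := Icc_subset_Icc le_rfl (by linarith [hd 0])
    rcases hj.lt_or_eq with hj | rfl
    · have := (convex_Icc 0 (d n - d 0)).norm_image_sub_le_of_norm_hasDerivWithin_le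
        (f := F n j) (f' := F n (j+1)) (C := |F 0 (j+1) 0|)
        (fun x hx => ((hF n).der _ hj x (hsub hx)).mono hsub)
        (fun x hx => hbd (j+1) (by omega) n x hx.1 hx.2) hs ht
      simp only [Real.norm_eq_abs] at this
      exact this.trans (by gcongr; linarith)
    · have hkey : |F n j t - F n j s| ≤ g 0 * |t - s| := by
        rcases le_total s t with hle | hle
        · rw [abs_of_nonneg (sub_nonneg.2 hle)]
          exact ((hF n).inc s t (hsub hs).1 hle (hsub ht).2).trans
            (g_int_le hg_c hg_anti (hsub hs).1 hle)
        · rw [abs_sub_comm, abs_sub_comm t, abs_of_nonneg (sub_nonneg.2 hle)]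
          exact ((hF n).inc t s (hsub ht).1 hle (hsub hs).2).trans
            (g_int_le hg_c hg_anti (hsub ht).1 hle)
      exact hkey.trans (by gcongr; linarith [abs_nonneg (F 0 (j+1) 0)])
  have hquad : ∀ j < p, ∀ n s t, s ∈ Icc 0 (d n - d 0) → t ∈ Icc 0 (d n - d 0) →
      |F n j t - F n j s - (t - s) * F n (j+1) s| ≤
        (|F 0 (j+1+1) 0| + g 0) * |t - s| * |t - s| := by
    intro j hj n s t hs ht
    have hsub : Icc 0 (d n - d 0) ⊆ Icc 0 (d n) := Icc_subset_Icc le_rfl (by linarith [hd 0])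
    have hsub2 : uIcc s t ⊆ Icc 0 (d n - d 0) := uIcc_subset_Icc hs ht
    have := (convex_uIcc s t).norm_image_sub_le_of_norm_hasDerivWithin_le
      (f := fun x => F n j x - x * F n (j+1) s) (f' := fun x => F n (j+1) x - 1 * F n (j+1) s)
      (C := (|F 0 (j+1+1) 0| + g 0) * |t - s|)
      (fun x hx => (((hF n).der _ hj x (hsub (hsub2 hx))).mono (hsub2.trans hsub)).sub
        ((hasDerivWithinAt_id x _).mul_const _))
      (fun x hx => by
        rw [one_mul, Real.norm_eq_abs]
        refine (hlip (j+1) (by omega) n s x hs (hsub2 hx)).trans ?_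
        gcongr ?_ * ?_
        exact abs_sub_left_of_mem_uIcc hx) left_mem_uIcc right_mem_uIcc
    simp only [Real.norm_eq_abs] at this
    convert this using 2
    ring
  have hex : ∀ j t, ∃ L, j ≤ p → 0 ≤ t → Tendsto (fun n => F n j t) U (𝓝 L) := by
    intro j t
    by_cases h : j ≤ p ∧ 0 ≤ t
    · have hmem : Icc (-|F 0 j 0|) (|F 0 j 0|) ∈ (U.map (fun n => F n j t)) := by
        rw [Ultrafilter.mem_map]
        filter_upwards [hlarge (t + d 0)] with n hn
        exact abs_le.1 (hbd j h.1 n t h.2 (by linarith))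
      obtain ⟨L, _, hL⟩ := isCompact_Icc.ultrafilter_le_nhds _ (le_principal_iff.2 hmem)
      exact ⟨L, fun _ _ => hL⟩
    · exact ⟨0, fun h1 h2 => absurd ⟨h1, h2⟩ h⟩
  choose y hy using hex
  refine ⟨y, fun j hj t ht => hy j t hj ht, ?_, ?_, ?_⟩
  · intro j hj s hs
    set C := |F 0 (j+1+1) 0| + g 0
    have hq : ∀ t, 0 ≤ t → |y j t - y j s - (t - s) * y (j+1) s| ≤ C * |t - s| * |t - s| := by
      intro t ht
      have hlim := (((hy j t hj.le ht).sub (hy j s hj.le hs)).sub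
        ((hy (j+1) s hj hs).const_mul (t - s))).abs
      refine le_of_tendsto hlim ?_
      filter_upwards [hlarge (t + d 0), hlarge (s + d 0)] with n h1 h2
      exact hquad j hj n s t ⟨hs, by linarith⟩ ⟨ht, by linarith⟩
    rw [hasDerivWithinAt_iff_isLittleO, Asymptotics.isLittleO_iff]
    intro c hc
    have hC : 0 < C := by positivity
    have : ∀ᶠ t in 𝓝[Ici 0] s, |t - s| < c / C := by
      refine nhdsWithin_le_nhds ?_
      have := Metric.ball_mem_nhds s (div_pos hc hC)
      filter_upwards [this] with t ht
      simpa [Real.dist_eq] using ht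
    filter_upwards [this, self_mem_nhdsWithin] with t h1 h2
    simp only [Real.norm_eq_abs, smul_eq_mul]
    refine (hq t h2).trans ?_
    rw [lt_div_iff₀ hC] at h1
    gcongr
    linarith
  · intro t ht
    refine le_of_tendsto (hy 0 t (by omega) ht).abs ?_
    filter_upwards [hlarge t] with n hn
    exact (hF n).bd t ⟨ht, hn⟩
  · intro s t hs hst
    refine le_of_tendsto ((hy p t le_rfl (hs.trans hst)).sub (hy p s le_rfl hs)).abs ?_
    filter_upwards [hlarge t] with n hn
    exact (hF n).inc s t hs hst hn

lemma bd_of_wNorm {x f : ℝ → ℝ} {S : Set ℝ} {δ : ℝ} (hf : ∀ t ∈ S, 0 < f t)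
    (hb : BddAbove ((fun t => |x t| / f t) '' S)) (h : wNorm x f S ≤ δ) :
    ∀ t ∈ S, |x t| ≤ δ * f t := by
  intro t ht
  have := (le_csSup hb ⟨t, ht, rfl⟩).trans h
  rwa [div_le_iff₀ (hf t ht)] at this

lemma der_of_contDiffOn {x : ℝ → ℝ} {S : Set ℝ} (hS : UniqueDiffOn ℝ S) {p : ℕ}
    (hx : ContDiffOn ℝ p x S) : ∀ j < p, ∀ t ∈ S,
      HasDerivWithinAt (iteratedDerivWithin j x S) (iteratedDerivWithin (j+1) x S t) S t := by
  intro j hj t ht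
  have := (hx.differentiableOn_iteratedDerivWithin (m := j) (by exact_mod_cast hj) hS t ht)
  rw [iteratedDerivWithin_succ]
  exact this.hasDerivWithinAt

lemma toSpl {f g : ℝ → ℝ} (hf_pos : ∀ t ∈ Ici (0:ℝ), 0 < f t)
    (hg_c : ContinuousOn g (Ici 0)) (hg_pos : ∀ t ∈ Ici (0:ℝ), 0 < g t)
    {δ : ℝ} (hδ : 0 < δ) {p n : ℕ} {a : ℝ} (ha : 0 < a) {G : ℝ → ℝ}
    (hG : IsExtremalSpline f g (p+1) n a G) (hn : wNorm G f (Icc 0 a) = δ) :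
    Spl f g δ p n a (fun j => iteratedDerivWithin j G (Icc 0 a)) := by
  obtain ⟨⟨m, hmn, u, ε, hε, hu0, hua, hum, hcd, hpc⟩, b, hb1, hbl, hbm, hbv⟩ := hG
  simp only [Nat.add_sub_cancel] at hcd
  have hUD : UniqueDiffOn ℝ (Icc 0 a) := uniqueDiffOn_Icc ha
  have hεa : |ε| = 1 := by rcases hε with rfl | rfl <;> simp
  have hpieces : ∀ i ≤ m, ∃ e : ℝ, |e| = 1 ∧ ∀ s t, u i ≤ s → s ≤ t → t ≤ u (i+1) →
      iteratedDerivWithin p G (Icc 0 a) t - iteratedDerivWithin p G (Icc 0 a) s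
        = e * ∫ v in s..t, g v := by
    intro i hi
    refine ⟨ε * (-1)^i, by rw [abs_mul, hεa, abs_pow]; simp, ?_⟩
    intro s t hs hst ht
    have hi0 := (u_mono hum i (by omega)).1
    have hi1 := (u_mono hum (i+1) (by omega)).2
    rw [hu0] at hi0
    rw [hua] at hi1
    have hsub : Icc s t ⊆ Icc 0 a := Icc_subset_Icc (hi0.trans hs) (ht.trans hi1)
    have hcont : ContinuousOn (iteratedDerivWithin p G (Icc 0 a)) (Icc 0 a) :=
      hcd.continuousOn_iteratedDerivWithin le_rfl hUD
    rw [← intervalIntegral.integral_const_mul]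
    symm
    refine intervalIntegral.integral_eq_sub_of_hasDerivAt_of_le hst (hcont.mono hsub) ?_ ?_
    · intro v hv
      have hvI : v ∈ Ioo (u i) (u (i+1)) := ⟨hs.trans_lt hv.1, hv.2.trans_le ht⟩
      obtain ⟨hc, hval⟩ := hpc i hi
      have h1 := der_of_contDiffOn isOpen_Ioo.uniqueDiffOn hc p (by omega) v hvI
      rw [hval v hvI] at h1
      have h2 := h1.hasDerivAt (isOpen_Ioo.mem_nhds hvI)
      refine h2.congr_of_eventuallyEq ?_
      filter_upwards [isOpen_Ioo.mem_nhds hvI] with w hw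
      have hw' : Icc 0 a ∈ 𝓝 w :=
        Icc_mem_nhds (hi0.trans_lt hw.1) (hw.2.trans_le hi1)
      have e1 : (Icc 0 a : Set ℝ) =ᶠ[𝓝 w] (Ioo (u i) (u (i+1)) : Set ℝ) := by
        filter_upwards [hw', isOpen_Ioo.mem_nhds hw] with z h1 h2
        exact propext ⟨fun _ => h2, fun _ => h1⟩
      rw [iteratedDerivWithin, iteratedDerivWithin, iteratedFDerivWithin_congr_set e1]
    · exact (g_int hg_c (hi0.trans hs) hst).const_mul _
  have hcont0 : ContinuousOn G (Icc 0 a) := hcd.continuousOn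
  have hbdd : BddAbove ((fun t => |G t| / f t) '' Icc 0 a) := by
    by_contra h
    rw [wNorm, Real.sSup_of_not_bddAbove h] at hn
    linarith
  have hincu : ∀ i ≤ m + 1, ∀ s t, 0 ≤ s → s ≤ t → t ≤ u i →
      |iteratedDerivWithin p G (Icc 0 a) t - iteratedDerivWithin p G (Icc 0 a) s|
        ≤ ∫ v in s..t, g v := by
    have hsame : ∀ i ≤ m, ∀ s t, u i ≤ s → s ≤ t → t ≤ u (i+1) →
      |iteratedDerivWithin p G (Icc 0 a) t - iteratedDerivWithin p G (Icc 0 a) s|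
        ≤ ∫ v in s..t, g v := by
      intro i hi s t hs hst ht
      have hi0 := (u_mono hum i (by omega)).1
      rw [hu0] at hi0
      obtain ⟨e, he, h⟩ := hpieces i hi
      rw [h s t hs hst ht, abs_mul, he, one_mul, abs_of_nonneg]
      exact intervalIntegral.integral_nonneg hst
        (fun v hv => (hg_pos v (hi0.trans (hs.trans hv.1))).le)
    intro i
    induction i with
    | zero =>
      intro _ s t hs hst ht
      rw [hu0] at ht
      obtain rfl : s = t := by linarith
      simp
    | succ i ih =>
      intro hi s t hs hst ht
      rcases le_total t (u i) with h1 | h1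
      · exact ih (by omega) s t hs hst h1
      rcases le_total (u i) s with h2 | h2
      · exact hsame i (by omega) s t h2 hst ht
      have e1 := ih (by omega) s (u i) hs h2 le_rfl
      have e2 := hsame i (by omega) (u i) t le_rfl h1 ht
      rw [← intervalIntegral.integral_add_adjacent_intervals (g_int hg_c hs h2)
        (g_int hg_c (hs.trans h2) h1)]
      have := abs_sub_le (iteratedDerivWithin p G (Icc 0 a) t)
        (iteratedDerivWithin p G (Icc 0 a) (u i)) (iteratedDerivWithin p G (Icc 0 a) s)
      linarith
  refine ⟨der_of_contDiffOn hUD hcd, ?_, ?_, ⟨m, hmn, u, hu0, hua, hum, hpieces⟩, ?_⟩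
  · intro t ht
    simp only [iteratedDerivWithin_zero]
    exact bd_of_wNorm (fun t ht => hf_pos t ht.1) hbdd hn.le t ht
  · intro s t hs hst ht
    exact hincu (m+1) le_rfl s t hs hst (by rw [hua]; exact ht)
  · have hlo : ∀ i, i < n + p + 2 → b 1 ≤ b (i+1) := by
      intro i
      induction i with
      | zero => intro _; exact le_rfl
      | succ i ih => intro h; exact (ih (by omega)).trans (hbm (i+1) (by omega) (by omega)).le
    have hhi : ∀ c i, i + c = n + p + 1 → b (i+1) ≤ a := by
      intro c
      induction c with
      | zero =>
        intro i hi
        rw [← hbl, show i + 1 = n + (p+1) + 1 by omega]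
      | succ c ih =>
        intro i hi
        exact (hbm (i+1) (by omega) (by omega)).le.trans (ih (i+1) (by omega))
    refine ⟨fun i => b (i+1), (-1)^(p+1), by rw [abs_pow]; simp, fun i hi => ⟨⟨?_, ?_⟩, ?_⟩, ?_⟩
    · exact hb1.trans (hlo i hi)
    · exact hhi (n+p+1-i) i (by omega)
    · simp only [iteratedDerivWithin_zero]
      rw [hbv (i+1) (by omega) (by omega), hn]
      ring
    · intro i hi
      exact hbm (i+1) (by omega) (by omega)

lemma toMemW {f g : ℝ → ℝ} (hf_pos : ∀ t ∈ Ici (0:ℝ), 0 < f t)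
    (hg_c : ContinuousOn g (Ici 0)) (hg_anti : AntitoneOn g (Ici 0))
    {δ : ℝ} {p : ℕ} {y : ℕ → ℝ → ℝ}
    (h1 : ∀ j < p, ∀ t ∈ Ici (0:ℝ), HasDerivWithinAt (y j) (y (j+1) t) (Ici 0) t)
    (h2 : ∀ t ∈ Ici (0:ℝ), |y 0 t| ≤ δ * f t)
    (h3 : ∀ s t, 0 ≤ s → s ≤ t → |y p t - y p s| ≤ ∫ v in s..t, g v) :
    MemW f g (p+1) (y 0) ∧ wNorm (y 0) f (Ici 0) ≤ δ ∧
      ∀ j ≤ p, EqOn (iteratedDerivWithin j (y 0) (Ici 0)) (y j) (Ici 0) := by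
  have hUD : UniqueDiffOn ℝ (Ici (0:ℝ)) := uniqueDiffOn_Ici 0
  have heq : ∀ j ≤ p, EqOn (iteratedDerivWithin j (y 0) (Ici 0)) (y j) (Ici 0) := by
    intro j
    induction j with
    | zero => intro _ t _; simp
    | succ j ih =>
      intro hj t ht
      rw [iteratedDerivWithin_succ, derivWithin_congr (ih (by omega)) (ih (by omega) ht)]
      exact (h1 j hj t ht).derivWithin (hUD t ht)
  have hcp : ContinuousOn (y p) (Ici 0) := by
    have : LipschitzOnWith (Real.toNNReal (g 0)) (y p) (Ici 0) := by
      refine LipschitzOnWith.of_dist_le_mul ?_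
      intro s hs t ht
      rw [Real.dist_eq, Real.dist_eq]
      have hle : g 0 ≤ (Real.toNNReal (g 0) : ℝ) := Real.le_coe_toNNReal _
      refine le_trans ?_ (mul_le_mul_of_nonneg_right hle (abs_nonneg _))
      rcases le_total s t with h | h
      · rw [abs_sub_comm, abs_sub_comm s, abs_of_nonneg (sub_nonneg.2 h)]
        exact (h3 s t hs h).trans (g_int_le hg_c hg_anti hs h)
      · rw [abs_of_nonneg (sub_nonneg.2 h)]
        exact (h3 t s ht h).trans (g_int_le hg_c hg_anti ht h)
    exact this.continuousOn
  have hcd : ContDiffOn ℝ p (y 0) (Ici 0) := by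
    refine contDiffOn_of_continuousOn_differentiableOn_deriv ?_ ?_
    · intro m hm
      have hm : m ≤ p := by exact_mod_cast hm
      refine ContinuousOn.congr ?_ (heq m hm)
      rcases hm.lt_or_eq with h | rfl
      · exact fun t ht => (h1 m h t ht).continuousWithinAt
      · exact hcp
    · intro m hm
      have hm : m < p := by exact_mod_cast hm
      exact DifferentiableOn.congr (fun t ht => (h1 m hm t ht).differentiableWithinAt)
        (heq m hm.le)
  have hle : ∀ v ∈ ((fun t => |y 0 t| / f t) '' Ici 0), v ≤ δ := by
    rintro _ ⟨t, ht, rfl⟩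
    simp only
    rw [div_le_iff₀ (hf_pos t ht)]
    exact h2 t ht
  refine ⟨⟨hcd.continuousOn, by simpa using hcd, ⟨δ, hle⟩, ?_⟩, ?_, heq⟩
  · intro s t hs hst
    rw [Nat.add_sub_cancel, heq p le_rfl hs, heq p le_rfl (mem_Ici.2 (hs.trans hst))]
    exact h3 s t hs hst
  · exact csSup_le (nonempty_Ici.image _) hle

/-- Theorem 4: if φ_{r,0,f}(∞) = ∞ then for every δ > 0 and k = 1, …, r-1,
ω(D^k, δ) = lim_{n→∞} |G_{r,n,f,δ_{r,n}}^{(k)}(0)|, where δ_{r,n} is chosen so that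
φ_{r,n,f}(δ_{r,n}) = δ. -/
theorem statement12
    (f g : ℝ → ℝ)
    (hf_c : ContinuousOn f (Ici 0)) (hf_pos : ∀ t ∈ Ici (0:ℝ), 0 < f t)
    (hf_anti : AntitoneOn f (Ici 0))
    (hg_c : ContinuousOn g (Ici 0)) (hg_pos : ∀ t ∈ Ici (0:ℝ), 0 < g t)
    (hg_anti : AntitoneOn g (Ici 0))
    (r : ℕ) (hr : 1 ≤ r)
    (φ0 : ℝ → ℝ)
    (hφ0 : ∀ a, 0 < a → ∃ G : ℝ → ℝ,
      IsExtremalSpline f g r 0 a G ∧ φ0 a = wNorm G f (Icc 0 a))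
    (hinf : ∀ C, ∃ a, 0 < a ∧ C < φ0 a)
    (δ : ℝ) (hδ : 0 < δ) (k : ℕ) (hk1 : 1 ≤ k) (hk2 : k < r)
    (d : ℕ → ℝ) (hd : ∀ n, 0 < d n)
    (Gn : ℕ → ℝ → ℝ) (hGn : ∀ n, IsExtremalSpline f g r n (d n) (Gn n))
    (hnorm : ∀ n, wNorm (Gn n) f (Icc 0 (d n)) = δ) :
    ∃ L : ℝ,
      Tendsto (fun n => |iteratedDerivWithin k (Gn n) (Icc 0 (d n)) 0|) atTop (nhds L) ∧
      omegaD f g r k δ = L := by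
  obtain ⟨p, rfl⟩ : ∃ p, r = p + 1 := ⟨r - 1, by omega⟩
  have hp : 0 < p := by omega
  have hkp : k ≤ p := by omega
  have hS : ∀ n, Spl f g δ p n (d n) (fun j => iteratedDerivWithin j (Gn n) (Icc 0 (d n))) :=
    fun n => toSpl hf_pos hg_c hg_pos hδ (hd n) (hGn n) (hnorm n)
  refine ⟨omegaD f g (p+1) k δ, ?_, rfl⟩
  have hub : ∀ n, ∀ x, MemW f g (p+1) x → wNorm x f (Ici 0) ≤ δ → ∀ t ∈ Ici (0:ℝ),
      |iteratedDerivWithin k x (Ici 0) t| ≤ |iteratedDerivWithin k (Gn n) (Icc 0 (d n)) 0| := by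
    rintro n x ⟨_, hx1, hx2, hx3⟩ hxn t ht
    rw [Nat.add_sub_cancel] at hx1 hx3
    exact compare_shift hf_pos hf_anti hg_c hg_pos hg_anti hδ hp (hd n) (hS n)
      (S := Ici 0) (y := fun j => iteratedDerivWithin j x (Ici 0)) ht
      (fun s hs => mem_Ici.2 (le_trans ht hs.1)) (der_of_contDiffOn (uniqueDiffOn_Ici 0) hx1)
      (by simpa using bd_of_wNorm hf_pos hx2 hxn)
      (fun s t h1 h2 _ => hx3 s t h1 h2) hkp
  have hub2 : ∀ n, ∀ v ∈ {y | ∃ x : ℝ → ℝ, MemW f g (p+1) x ∧ wNorm x f (Ici 0) ≤ δ ∧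
      y = supNorm (iteratedDerivWithin k x (Ici 0)) (Ici 0)},
      v ≤ |iteratedDerivWithin k (Gn n) (Icc 0 (d n)) 0| := by
    rintro n _ ⟨x, hx, hxn, rfl⟩
    refine csSup_le (nonempty_Ici.image _) ?_
    rintro _ ⟨t, ht, rfl⟩
    exact hub n x hx hxn t ht
  rw [tendsto_iff_ultrafilter]
  intro U hU
  obtain ⟨y, hy0, hy1, hy2, hy3⟩ := limit_fn hf_pos hf_anti hg_c hg_pos hg_anti hδ hp hd hS U hU
  obtain ⟨hW, hN, heq⟩ := toMemW hf_pos hg_c hg_anti hy1 hy2 hy3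
  have hlim := (hy0 k hkp 0 le_rfl).abs
  have hmem : supNorm (iteratedDerivWithin k (y 0) (Ici 0)) (Ici 0) ∈
      {y | ∃ x : ℝ → ℝ, MemW f g (p+1) x ∧ wNorm x f (Ici 0) ≤ δ ∧
      y = supNorm (iteratedDerivWithin k x (Ici 0)) (Ici 0)} := ⟨y 0, hW, hN, rfl⟩
  have hle1 : |y k 0| ≤ omegaD f g (p+1) k δ := by
    refine le_trans ?_ (le_csSup ⟨_, hub2 0⟩ hmem)
    rw [← heq k hkp (mem_Ici.2 le_rfl)]
    refine le_csSup ⟨|iteratedDerivWithin k (Gn 0) (Icc 0 (d 0)) 0|, ?_⟩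
      ⟨0, mem_Ici.2 le_rfl, rfl⟩
    rintro _ ⟨t, ht, rfl⟩
    exact hub 0 _ hW hN t ht
  have hle2 : omegaD f g (p+1) k δ ≤ |y k 0| :=
    ge_of_tendsto' hlim (fun n => csSup_le ⟨_, hmem⟩ (hub2 n))
  rw [le_antisymm hle2 hle1]
  exact hlim
end
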